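/- Let 1 ≤ p ≤ n−1 and consider the operators ∂ : A²_{(p,0)}(ℂⁿ, e^{-|z|²}) → A²_{(p+1,0)}(ℂⁿ, e^{-|z|²}) and its adjoint ∂*. Then (ker ∂)^⊥ = ker ∂* in A²_{(p,0)}(ℂⁿ, e^{-|z|²}), and both ∂ and ∂* have closed range. -/

import Mathlib

open MeasureTheory Filter Complex Finset

noncomputable section

/-- Points of `ℂⁿ`. -/
abbrev Cn (n : ℕ) := Fin n → ℂ

/-- A form with coefficients indexed by subsets of `{1,…,n}`; a `(p,0)`-form
`Σ'_{|J|=p} u_J dz_J` is such a family supported on sets of cardinality `p`. -/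
abbrev FormC (n : ℕ) := Finset (Fin n) → Cn n → ℂ

/-- The Fock weight `e^{-|z|²}` on `ℂⁿ`. -/
def fWt {n : ℕ} (z : Cn n) : ℝ := Real.exp (-(∑ j, ‖z j‖ ^ 2))

/-- Squared Fock norm `‖f‖² = ∫ |f|² e^{-|z|²} dλ`. -/
def fNormSq {n : ℕ} (f : Cn n → ℂ) : ℝ := ∫ z : Cn n, ‖f z‖ ^ 2 * fWt z

/-- Fock inner product `(f,g) = ∫ f ḡ e^{-|z|²} dλ`. -/
def fInner {n : ℕ} (f g : Cn n → ℂ) : ℂ :=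
  ∫ z : Cn n, f z * (starRingEnd ℂ) (g z) * fWt z

/-- Membership in the Fock space `A²(ℂⁿ, e^{-|z|²})`. -/
def MemF {n : ℕ} (f : Cn n → ℂ) : Prop :=
  Differentiable ℂ f ∧ Integrable (fun z : Cn n => ‖f z‖ ^ 2 * fWt z)

/-- The holomorphic partial derivative `∂f/∂z_j`. -/
def pdz {n : ℕ} (j : Fin n) (f : Cn n → ℂ) : Cn n → ℂ :=
  fun z => fderiv ℂ f z (Pi.single j 1)

/-- The sign `(-1)^{#{i ∈ J : i < j}}` arising from `dz_j ∧ dz_J`. -/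
def sgn {n : ℕ} (j : Fin n) (J : Finset (Fin n)) : ℂ :=
  (-1 : ℂ) ^ (J.filter (fun i => i < j)).card

/-- The operator `∂`: `(∂u)_L = Σ_{j ∈ L} ± ∂u_{L\{j}}/∂z_j`, i.e.
`∂u = Σ'_J Σ_j (∂u_J/∂z_j) dz_j ∧ dz_J`. -/
def dOp {n : ℕ} (u : FormC n) : FormC n :=
  fun L z => ∑ j ∈ L, sgn j (L.erase j) * pdz j (u (L.erase j)) z

/-- The adjoint `∂*`: `(∂*u)_K = Σ_{j ∉ K} ± z_j u_{K ∪ {j}}`, i.e.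
`∂*u = Σ'_K Σ_j z_j u_{jK} dz_K` on the Fock space. -/
def dStarOp {n : ℕ} (u : FormC n) : FormC n :=
  fun K z => ∑ j ∈ Kᶜ, sgn j K * (z j * u (insert j K) z)

/-- The complex Laplacian `□̃ = ∂*∂ + ∂∂*`. -/
def boxOp {n : ℕ} (u : FormC n) : FormC n :=
  fun J z => dStarOp (dOp u) J z + dOp (dStarOp u) J z

/-- All coefficients belong to the Fock space. -/
def MemA2 {n : ℕ} (u : FormC n) : Prop := ∀ J, MemF (u J)

/-- `u` is a `(p,0)`-form: only coefficients with `|J| = p` may be nonzero. -/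
def IsDeg {n : ℕ} (p : ℕ) (u : FormC n) : Prop :=
  ∀ J : Finset (Fin n), J.card ≠ p → u J = 0

/-- Squared norm of a form: `Σ'_J ‖u_J‖²`. -/
def formNormSq {n : ℕ} (u : FormC n) : ℝ := ∑ J : Finset (Fin n), fNormSq (u J)

/-- Inner product of forms: `Σ'_J (u_J, v_J)`. -/
def formInner {n : ℕ} (u v : FormC n) : ℂ := ∑ J : Finset (Fin n), fInner (u J) (v J)

/-- `u ∈ dom ∂`. -/
def domD {n : ℕ} (u : FormC n) : Prop := MemA2 u ∧ MemA2 (dOp u)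

/-- `u ∈ dom ∂*`. -/
def domDs {n : ℕ} (u : FormC n) : Prop := MemA2 u ∧ MemA2 (dStarOp u)

/-- `u ∈ dom □̃`: `u ∈ dom ∂ ∩ dom ∂*`, `∂u ∈ dom ∂*` and `∂*u ∈ dom ∂`. -/
def domBox {n : ℕ} (u : FormC n) : Prop :=
  domD u ∧ domDs u ∧ domDs (dOp u) ∧ domD (dStarOp u)

/-- The monomial `z^α`. -/
def mono {n : ℕ} (α : Fin n → ℕ) (z : Cn n) : ℂ := ∏ j, z j ^ α j

/-- `f` is the sum of the everywhere convergent power series with coefficients `a`. -/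
def HasCoeff {n : ℕ} (f : Cn n → ℂ) (a : (Fin n → ℕ) → ℂ) : Prop :=
  ∀ z, HasSum (fun α => a α * mono α z) (f z)

lemma norm_mono_le {n : ℕ} (α : Fin n → ℕ) {z : Cn n} {R : ℝ} (hz : ‖z‖ ≤ R) :
    ‖mono α z‖ ≤ R ^ ∑ j, α j := by
  rw [mono, norm_prod, ← Finset.prod_pow_eq_pow_sum]
  refine Finset.prod_le_prod (fun _ _ => norm_nonneg _) fun j _ => ?_
  rw [norm_pow]
  exact pow_le_pow_left₀ (norm_nonneg _) ((norm_le_pi_norm z j).trans hz) _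

lemma mono_const {n : ℕ} (α : Fin n → ℕ) (R : ℂ) :
    mono α (fun _ => R) = R ^ ∑ j, α j := by
  rw [mono, Finset.prod_pow_eq_pow_sum]

lemma differentiable_mono {n : ℕ} (α : Fin n → ℕ) : Differentiable ℂ (mono α) := by
  unfold mono; fun_prop

/-- Cauchy's estimate for the Fréchet derivative of an entire function. -/
lemma norm_fderiv_le_of_bound {n : ℕ} {f : Cn n → ℂ} (hf : Differentiable ℂ f) {z : Cn n} {M : ℝ}
    (hM : ∀ w, ‖w - z‖ ≤ 1 → ‖f w‖ ≤ M) : ‖fderiv ℂ f z‖ ≤ M := by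
  have hM0 : 0 ≤ M := (norm_nonneg _).trans (hM z (by simp))
  refine ContinuousLinearMap.opNorm_le_bound _ hM0 fun v => ?_
  rcases eq_or_ne v 0 with rfl | hv
  · simp
  have hv' : 0 < ‖v‖ := norm_pos_iff.mpr hv
  have hd : HasDerivAt (fun t : ℂ => f (z + t • v)) (fderiv ℂ f z v) 0 := by
    have h1 : HasDerivAt (fun t : ℂ => z + t • v) v 0 := by
      simpa using ((hasDerivAt_id (0 : ℂ)).smul_const v).const_add z
    have h2 : HasFDerivAt f (fderiv ℂ f z) (z + (0 : ℂ) • v) := by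
      simpa using (hf z).hasFDerivAt
    exact h2.comp_hasDerivAt (0 : ℂ) h1
  have := Complex.norm_deriv_le_of_forall_mem_sphere_norm_le (c := 0) (R := ‖v‖⁻¹) (C := M)
    (f := fun t : ℂ => f (z + t • v)) (inv_pos.mpr hv')
    (by apply Differentiable.diffContOnCl; fun_prop)
    (fun t ht => hM _ (by
      have : ‖t‖ = ‖v‖⁻¹ := by simpa using ht
      simp [norm_smul, this, hv'.ne']))
  rwa [hd.deriv, div_inv_eq_mul] at this

lemma exists_bound_closedBall {n : ℕ} {f : Cn n → ℂ} (hf : Continuous f) (R : ℝ) :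
    ∃ M, 0 ≤ M ∧ ∀ w, ‖w‖ ≤ R → ‖f w‖ ≤ M := by
  obtain ⟨M, hM⟩ := (isCompact_closedBall (0 : Cn n) R).exists_bound_of_continuousOn hf.continuousOn
  exact ⟨max M 0, le_max_right _ _, fun w hw => (hM w (by simpa using hw)).trans (le_max_left _ _)⟩

lemma pdz_eq_integral {n : ℕ} {f : Cn n → ℂ} (hf : Differentiable ℂ f) (j : Fin n) (z : Cn n) :
    pdz j f z = (2 * Real.pi * I)⁻¹ * ∫ θ in (0 : ℝ)..2 * Real.pi,
      deriv (circleMap 0 1) θ * ((circleMap 0 1 θ ^ 2)⁻¹ *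
        f (z + circleMap 0 1 θ • Pi.single j (1 : ℂ))) := by
  have h := two_pi_I_inv_smul_circleIntegral_sub_sq_inv_smul_of_differentiable
    (U := Set.univ) (c := (0 : ℂ)) (R := 1) (w₀ := 0)
    (f := fun t : ℂ => f (z + t • Pi.single j (1 : ℂ))) isOpen_univ (Set.subset_univ _)
    (by fun_prop) (by simp)
  have hd : HasDerivAt (fun t : ℂ => f (z + t • Pi.single j (1 : ℂ))) (pdz j f z) 0 := by
    have h1 : HasDerivAt (fun t : ℂ => z + t • (Pi.single j (1 : ℂ) : Cn n)) (Pi.single j 1) 0 := by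
      simpa using ((hasDerivAt_id (0 : ℂ)).smul_const (Pi.single j (1 : ℂ) : Cn n)).const_add z
    have h2 : HasFDerivAt f (fderiv ℂ f z) (z + (0 : ℂ) • Pi.single j (1 : ℂ)) := by
      simpa using (hf z).hasFDerivAt
    exact h2.comp_hasDerivAt (0 : ℂ) h1
  rw [hd.deriv] at h
  rw [← h, circleIntegral]
  simp [smul_eq_mul]

lemma differentiable_pdz {n : ℕ} {f : Cn n → ℂ} (hf : Differentiable ℂ f) (j : Fin n) :
    Differentiable ℂ (pdz j f) := by
  rw [show pdz j f = _ from funext (pdz_eq_integral hf j)]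
  refine Differentiable.const_mul (fun z₀ => ?_) _
  obtain ⟨M, hM0, hM⟩ := exists_bound_closedBall hf.continuous (‖z₀‖ + 3)
  have hc : Continuous fun θ : ℝ => circleMap (0 : ℂ) 1 θ := continuous_circleMap 0 1
  have hK : Continuous fun θ : ℝ => deriv (circleMap (0 : ℂ) 1) θ * (circleMap 0 1 θ ^ 2)⁻¹ := by
    simp only [deriv_circleMap]
    refine (hc.mul continuous_const).mul (Continuous.inv₀ (by fun_prop) fun θ => ?_)
    simp
  have hF : ∀ z : Cn n, Continuous fun θ : ℝ => deriv (circleMap (0 : ℂ) 1) θ *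
      ((circleMap 0 1 θ ^ 2)⁻¹ * f (z + circleMap 0 1 θ • Pi.single j (1 : ℂ))) := fun z => by
    simp only [← mul_assoc]
    have := hf.continuous
    exact hK.mul (by fun_prop)
  have hKn : ∀ θ : ℝ, ‖deriv (circleMap (0 : ℂ) 1) θ * (circleMap 0 1 θ ^ 2)⁻¹‖ = 1 := fun θ => by
    simp
  refine (intervalIntegral.hasFDerivAt_integral_of_dominated_of_fderiv_le
    (F' := fun z θ => (deriv (circleMap (0 : ℂ) 1) θ * (circleMap 0 1 θ ^ 2)⁻¹) •
      fderiv ℂ f (z + circleMap 0 1 θ • Pi.single j (1 : ℂ)))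
    (bound := fun _ => M) (s := Metric.ball z₀ 1) (Metric.ball_mem_nhds _ one_pos)
    ?_ ?_ ?_ ?_ ?_ ?_).differentiableAt
  · exact Eventually.of_forall fun z => (hF z).aestronglyMeasurable
  · exact (hF z₀).intervalIntegrable _ _
  · refine (hK.measurable.smul ((measurable_fderiv ℂ f).comp ?_)).aestronglyMeasurable
    exact (Continuous.measurable (by fun_prop))
  · refine Eventually.of_forall fun θ _ z hz => ?_
    rw [norm_smul, hKn, one_mul]
    refine norm_fderiv_le_of_bound hf fun w hw => hM w ?_
    have h1 : ‖z - z₀‖ < 1 := by simpa [dist_eq_norm] using hz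
    have h2 : ‖circleMap 0 1 θ • (Pi.single j (1 : ℂ) : Cn n)‖ = 1 := by
      simp [norm_smul, Pi.norm_single]
    calc ‖w‖ = ‖(w - (z + circleMap 0 1 θ • Pi.single j (1 : ℂ))) + (z - z₀) + z₀ +
          circleMap 0 1 θ • Pi.single j (1 : ℂ)‖ := by congr 1; abel
      _ ≤ _ := norm_add_le _ _
      _ ≤ _ := add_le_add_left (norm_add_le _ _) _
      _ ≤ _ := add_le_add_left (add_le_add_left (norm_add_le _ _) _) _
      _ ≤ _ := by rw [h2]; linarith
  · exact intervalIntegrable_const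
  · refine Eventually.of_forall fun θ _ z _ => ?_
    simp only [← mul_assoc]
    have := (hf (z + circleMap 0 1 θ • Pi.single j (1 : ℂ))).hasFDerivAt.comp z
      ((hasFDerivAt_id z).add_const (circleMap 0 1 θ • Pi.single j (1 : ℂ)))
    simpa using this.const_mul (deriv (circleMap (0 : ℂ) 1) θ * (circleMap 0 1 θ ^ 2)⁻¹)

lemma summable_pi_prod_of_nonneg (n : ℕ) {g : ℕ → ℝ} (h0 : ∀ k, 0 ≤ g k) (hg : Summable g) :
    Summable fun α : Fin n → ℕ => ∏ j, g (α j) := by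
  induction n with
  | zero => exact Summable.of_finite
  | succ n ih =>
    rw [← (Fin.consEquiv (fun _ => ℕ)).summable_iff]
    refine (hg.mul_of_nonneg ih h0 fun α => Finset.prod_nonneg fun j _ => h0 _).congr fun x => ?_
    simp [Fin.consEquiv, Fin.prod_univ_succ]

lemma summable_pow_sum (n : ℕ) {r : ℝ} (h0 : 0 ≤ r) (h1 : r < 1) :
    Summable fun α : Fin n → ℕ => r ^ ∑ j, α j :=
  (summable_pi_prod_of_nonneg n (fun k => pow_nonneg h0 k) (summable_geometric_of_lt_one h0 h1)).congr
    fun _ => Finset.prod_pow_eq_pow_sum _ _ _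

/-- Cauchy bounds on the coefficients force the power series to converge everywhere. -/
lemma summable_of_cauchy_bound {n : ℕ} {a : (Fin n → ℕ) → ℂ}
    (ha : ∀ R : ℝ, 0 < R → ∃ M, ∀ α, ‖a α‖ * R ^ ∑ j, α j ≤ M) (R : ℝ) (hR : 0 < R) :
    Summable fun α => ‖a α‖ * R ^ ∑ j, α j := by
  obtain ⟨M, hM⟩ := ha (2 * R) (by positivity)
  refine Summable.of_nonneg_of_le (fun α => by positivity) (fun α => ?_)
    ((summable_pow_sum n (r := 1 / 2) (by norm_num) (by norm_num)).mul_left M)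
  calc ‖a α‖ * R ^ ∑ j, α j = ‖a α‖ * (2 * R) ^ (∑ j, α j) * (1 / 2) ^ (∑ j, α j) := by
        rw [mul_assoc, ← mul_pow]; congr 2; ring
    _ ≤ _ := by gcongr; exact hM α

lemma deriv_comp_cons {n : ℕ} {f : Cn (n + 1) → ℂ} (hf : Differentiable ℂ f) (w : Cn n) (t : ℂ) :
    deriv (fun s : ℂ => f (Fin.cons s w)) t = pdz 0 f (Fin.cons t w) := by
  have h1 : HasDerivAt (fun s : ℂ => (Fin.cons s w : Cn (n + 1))) (Pi.single 0 1) t := by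
    rw [hasDerivAt_pi]
    intro i
    refine Fin.cases ?_ (fun i => ?_) i
    · simpa [Fin.cons_zero] using hasDerivAt_id' t
    · simpa [Pi.single_apply] using hasDerivAt_const t (w i)
  exact ((hf _).hasFDerivAt.comp_hasDerivAt t h1).deriv

lemma differentiable_cons {n : ℕ} (w : Cn n) :
    Differentiable ℂ (fun s : ℂ => (Fin.cons s w : Cn (n + 1))) := by
  rw [differentiable_pi]
  intro i
  refine Fin.cases ?_ (fun i => ?_) i <;> simp

lemma differentiable_iterate_pdz {n : ℕ} {f : Cn n → ℂ} (hf : Differentiable ℂ f) (j : Fin n)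
    (k : ℕ) : Differentiable ℂ ((pdz j)^[k] f) := by
  induction k with
  | zero => exact hf
  | succ k ih => rw [Function.iterate_succ_apply']; exact differentiable_pdz ih j

lemma iteratedDeriv_comp_cons {n : ℕ} {f : Cn (n + 1) → ℂ} (hf : Differentiable ℂ f) (w : Cn n)
    (k : ℕ) : iteratedDeriv k (fun s : ℂ => f (Fin.cons s w)) =
      fun t => (pdz 0)^[k] f (Fin.cons t w) := by
  induction k with
  | zero => simp
  | succ k ih =>
    rw [iteratedDeriv_succ, ih]
    funext t
    rw [deriv_comp_cons (differentiable_iterate_pdz hf 0 k), Function.iterate_succ_apply']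

lemma norm_cons_le {n : ℕ} {t : ℂ} {w : Cn n} {R : ℝ} (ht : ‖t‖ ≤ R) (hw : ‖w‖ ≤ R) :
    ‖(Fin.cons t w : Cn (n + 1))‖ ≤ R := by
  rw [pi_norm_le_iff_of_nonneg ((norm_nonneg _).trans ht)]
  intro i
  refine Fin.cases (by simpa using ht) (fun i => ?_) i
  simpa using (norm_le_pi_norm w i).trans hw

/-- An entire function of several variables is the sum of its power series, whose coefficients
satisfy Cauchy's estimates. -/
theorem exists_hasCoeff_cauchy {n : ℕ} : ∀ {f : Cn n → ℂ}, Differentiable ℂ f →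
    ∃ a, HasCoeff f a ∧ ∀ R : ℝ, 0 < R → ∀ M, (∀ z, ‖z‖ ≤ R → ‖f z‖ ≤ M) →
      ∀ α, ‖a α‖ * R ^ ∑ j, α j ≤ M := by
  induction n with
  | zero =>
    intro f _
    refine ⟨fun _ => f 0, fun z => ?_, fun R hR M hM α => ?_⟩
    · rw [Subsingleton.elim z 0]
      convert! hasSum_unique (fun α : Fin 0 → ℕ => f 0 * mono α 0) using 1
      simp [mono]
    · simpa using hM 0 (by rw [norm_zero]; exact hR.le)
  | succ n ih =>
    intro f hf
    have hc : ∀ k : ℕ, Differentiable ℂ fun w : Cn n =>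
        (k.factorial : ℂ)⁻¹ * (pdz 0)^[k] f (Fin.cons 0 w) := fun k => by
      refine Differentiable.const_mul ((differentiable_iterate_pdz hf 0 k).comp ?_) _
      rw [differentiable_pi]
      intro i
      refine Fin.cases ?_ (fun i => ?_) i
      · simp
      · simpa using differentiable_apply i
    choose a ha hab using fun k => ih (hc k)
    let b : (Fin (n + 1) → ℕ) → ℂ := fun α => a (α 0) (Fin.tail α)
    have hb : ∀ R : ℝ, 0 < R → ∀ M, (∀ z, ‖z‖ ≤ R → ‖f z‖ ≤ M) →
        ∀ α, ‖b α‖ * R ^ ∑ j, α j ≤ M := by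
      intro R hR M hM α
      have h1 := hab (α 0) R hR (M / R ^ α 0) (fun w hw => by
        have h2 := Complex.norm_iteratedDeriv_le_of_forall_mem_sphere_norm_le (α 0) hR
          (c := 0) (C := M) (f := fun s : ℂ => f (Fin.cons s w))
          (hf.comp (differentiable_cons w)).diffContOnCl
          (fun t ht => hM _ (norm_cons_le (by simpa using (mem_sphere_zero_iff_norm.mp ht).le) hw))
        rw [iteratedDeriv_comp_cons hf] at h2
        rw [norm_mul, norm_inv, Complex.norm_natCast, inv_mul_le_iff₀ (by positivity)]
        rwa [mul_div_assoc] at h2) (Fin.tail α)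
      rw [le_div_iff₀ (by positivity)] at h1
      rw [Fin.sum_univ_succ, pow_add]
      calc _ = ‖a (α 0) (Fin.tail α)‖ * R ^ (∑ j, Fin.tail α j) * R ^ α 0 := by
            simp only [b, Fin.tail]; ring
        _ ≤ M := h1
    refine ⟨b, fun z => ?_, hb⟩
    have hs : Summable fun α => b α * mono α z := by
      refine Summable.of_norm_bounded (summable_of_cauchy_bound (a := b) (fun R hR => ?_)
        (‖z‖ + 1) (by positivity)) (fun α => ?_)
      · obtain ⟨M, _, hM⟩ := exists_bound_closedBall hf.continuous R
        exact ⟨M, hb R hR M hM⟩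
      · rw [norm_mul]
        gcongr
        exact norm_mono_le α (by linarith)
    have hs' := (Fin.consEquiv (fun _ => ℕ)).hasSum_iff.mpr hs.hasSum
    have hfib := hs'.prod_fiberwise
      (g := fun k => z 0 ^ k * ((k.factorial : ℂ)⁻¹ * (pdz 0)^[k] f (Fin.cons 0 (Fin.tail z))))
      (fun k => by
        have h := (ha k (Fin.tail z)).mul_left (z 0 ^ k)
        refine h.congr_fun fun β => ?_
        simp only [Function.comp_apply, Fin.consEquiv_apply, b, mono, Fin.prod_univ_succ,
          Fin.cons_zero, Fin.cons_succ, Fin.tail]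
        rw [show Fin.tail ((Fin.consEquiv fun _ => ℕ) (k, β)) = β from rfl]
        ring)
    have ht := Complex.hasSum_taylorSeries_of_entire (hf.comp (differentiable_cons (Fin.tail z)))
      0 (z 0)
    simp only [Function.comp_def, Fin.cons_self_tail, iteratedDeriv_comp_cons hf] at ht
    have heq : f z = ∑' α, b α * mono α z := by
      refine ht.unique (hfib.congr_fun fun k => ?_)
      simp only [sub_zero, smul_eq_mul]
      ring
    rw [heq]
    exact hs.hasSum

lemma HasCoeff.summable_norm {n : ℕ} {f : Cn n → ℂ} {a : (Fin n → ℕ) → ℂ} (h : HasCoeff f a)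
    {R : ℝ} (hR : 0 ≤ R) : Summable fun α => ‖a α‖ * R ^ ∑ j, α j := by
  refine (h fun _ => (R : ℂ)).summable.norm.congr fun α => ?_
  rw [norm_mul, mono_const, norm_pow, Complex.norm_real, Real.norm_of_nonneg hR]

/-- Termwise differentiation of an everywhere convergent power series. -/
lemma hasFDerivAt_tsum_mono {n : ℕ} {a : (Fin n → ℕ) → ℂ}
    (ha : ∀ R : ℝ, 0 ≤ R → Summable fun α => ‖a α‖ * R ^ ∑ j, α j) (z : Cn n) :
    Summable (fun α => a α • fderiv ℂ (mono α) z) ∧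
    HasFDerivAt (fun w => ∑' α, a α * mono α w) (∑' α, a α • fderiv ℂ (mono α) z) z := by
  have hb : ∀ α, ∀ w ∈ Metric.ball (0 : Cn n) (‖z‖ + 1),
      ‖a α • fderiv ℂ (mono α) w‖ ≤ ‖a α‖ * (‖z‖ + 2) ^ ∑ j, α j := fun α w hw => by
    rw [norm_smul]
    gcongr
    refine norm_fderiv_le_of_bound (differentiable_mono α) fun v hv => norm_mono_le α ?_
    have h1 : ‖w‖ < ‖z‖ + 1 := by simpa using hw
    have h2 := norm_add_le (v - w) w
    rw [sub_add_cancel] at h2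
    linarith
  have hz : z ∈ Metric.ball (0 : Cn n) (‖z‖ + 1) := by simp
  have hu := ha (‖z‖ + 2) (by positivity)
  refine ⟨Summable.of_norm_bounded hu fun α => hb α z hz, ?_⟩
  refine hasFDerivAt_tsum_of_isPreconnected (f' := fun α w => a α • fderiv ℂ (mono α) w) hu
    Metric.isOpen_ball (convex_ball _ _).isPreconnected
    (fun α w _ => ((differentiable_mono α w).hasFDerivAt.const_mul (a α))) hb hz ?_ hz
  refine Summable.of_norm_bounded (ha ‖z‖ (norm_nonneg _)) fun α => ?_
  rw [norm_mul]
  gcongr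
  exact norm_mono_le α le_rfl

lemma HasCoeff.eq_tsum {n : ℕ} {f : Cn n → ℂ} {a : (Fin n → ℕ) → ℂ} (h : HasCoeff f a) :
    f = fun w => ∑' α, a α * mono α w := funext fun w => (h w).tsum_eq.symm

lemma HasCoeff.differentiable {n : ℕ} {f : Cn n → ℂ} {a : (Fin n → ℕ) → ℂ} (h : HasCoeff f a) :
    Differentiable ℂ f := by
  rw [h.eq_tsum]
  exact fun z => (hasFDerivAt_tsum_mono (fun R hR => h.summable_norm hR) z).2.differentiableAt

/-- The action of `∂/∂z_j` on power series coefficients. -/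
def cD {n : ℕ} (j : Fin n) (a : (Fin n → ℕ) → ℂ) : (Fin n → ℕ) → ℂ :=
  fun α => (α j + 1) * a (α + Pi.single j 1)

/-- The action of multiplication by `z_j` on power series coefficients. -/
def cM {n : ℕ} (j : Fin n) (a : (Fin n → ℕ) → ℂ) : (Fin n → ℕ) → ℂ :=
  fun α => if α j = 0 then 0 else a (α - Pi.single j 1)

lemma mono_add_single {n : ℕ} (j : Fin n) (α : Fin n → ℕ) (z : Cn n) :
    mono (α + Pi.single j 1) z = z j * mono α z := by
  simp only [mono, Pi.add_apply, pow_add, Finset.prod_mul_distrib]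
  rw [mul_comm]
  congr 1
  rw [Finset.prod_eq_single j] <;> simp +contextual

lemma sub_single_add {n : ℕ} {j : Fin n} {α : Fin n → ℕ} (h : α j ≠ 0) :
    α - Pi.single j 1 + Pi.single j 1 = α := by
  funext i
  rcases eq_or_ne i j with rfl | hij
  · simp; omega
  · simp [hij]

lemma mem_range_add_single {n : ℕ} {j : Fin n} {α : Fin n → ℕ}
    (h : α ∉ Set.range fun β : Fin n → ℕ => β + Pi.single j 1) : α j = 0 := by
  by_contra h0
  exact h ⟨_, sub_single_add h0⟩

lemma fderiv_mono_single {n : ℕ} (j : Fin n) (α : Fin n → ℕ) (z : Cn n) :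
    fderiv ℂ (mono α) z (Pi.single j 1) =
      α j * z j ^ (α j - 1) * ∏ i ∈ univ.erase j, z i ^ α i := by
  have h1 : HasDerivAt (fun t : ℂ => z + t • (Pi.single j (1 : ℂ) : Cn n)) (Pi.single j 1) 0 := by
    simpa using ((hasDerivAt_id (0 : ℂ)).smul_const (Pi.single j (1 : ℂ) : Cn n)).const_add z
  have h2 : HasFDerivAt (mono α) (fderiv ℂ (mono α) z) (z + (0 : ℂ) • Pi.single j (1 : ℂ)) := by
    simpa using (differentiable_mono α z).hasFDerivAt
  have h3 := h2.comp_hasDerivAt (0 : ℂ) h1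
  have h4 : (mono α ∘ fun t : ℂ => z + t • (Pi.single j (1 : ℂ) : Cn n)) =
      fun t => (z j + t) ^ α j * ∏ i ∈ univ.erase j, z i ^ α i := by
    funext t
    rw [Function.comp_apply, mono, ← Finset.mul_prod_erase _ _ (mem_univ j)]
    congr 1
    · simp
    · refine Finset.prod_congr rfl fun i hi => ?_
      simp [(Finset.mem_erase.mp hi).1]
  rw [h4] at h3
  have h5 := (((hasDerivAt_id (0 : ℂ)).const_add (z j)).pow (α j)).mul_const
    (∏ i ∈ univ.erase j, z i ^ α i)
  simpa using h3.unique h5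

lemma fderiv_mono_add_single {n : ℕ} (j : Fin n) (α : Fin n → ℕ) (z : Cn n) :
    fderiv ℂ (mono (α + Pi.single j 1)) z (Pi.single j 1) = (α j + 1) * mono α z := by
  rw [fderiv_mono_single, mono, ← Finset.mul_prod_erase _ _ (mem_univ j), ← mul_assoc]
  congr 1
  · simp
  · refine Finset.prod_congr rfl fun i hi => ?_
    simp [(Finset.mem_erase.mp hi).1]

lemma fderiv_mono_eq_zero {n : ℕ} {j : Fin n} {α : Fin n → ℕ} (h : α j = 0) (z : Cn n) :
    fderiv ℂ (mono α) z (Pi.single j 1) = 0 := by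
  simp [fderiv_mono_single, h]

lemma HasCoeff.pdz {n : ℕ} {f : Cn n → ℂ} {a : (Fin n → ℕ) → ℂ} (h : HasCoeff f a) (j : Fin n) :
    HasCoeff (pdz j f) (cD j a) := by
  intro z
  obtain ⟨hs, hd⟩ := hasFDerivAt_tsum_mono (fun R hR => h.summable_norm hR) z
  have h1 := hs.hasSum.mapL (ContinuousLinearMap.apply ℂ ℂ (Pi.single j (1 : ℂ) : Cn n))
  rw [← hd.fderiv, ← h.eq_tsum] at h1
  rw [← (add_left_injective (Pi.single j 1)).hasSum_iff] at h1
  · refine h1.congr_fun fun α => ?_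
    simp only [cD, Function.comp_apply, ContinuousLinearMap.apply_apply,
      _root_.smul_apply, fderiv_mono_add_single, smul_eq_mul]
    ring
  · intro α hα
    simp [fderiv_mono_eq_zero (mem_range_add_single hα)]

lemma HasCoeff.mul_coord {n : ℕ} {f : Cn n → ℂ} {a : (Fin n → ℕ) → ℂ} (h : HasCoeff f a)
    (j : Fin n) : HasCoeff (fun z => z j * f z) (cM j a) := by
  intro z
  rw [← (add_left_injective (Pi.single j 1)).hasSum_iff]
  · refine ((h z).mul_left (z j)).congr_fun fun α => ?_
    simp [cM, mono_add_single]
    ring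
  · intro α hα
    simp [cM, mem_range_add_single hα]

/-- The radial moments of the Gaussian weight on a disc. -/
def discMoment (k : ℕ) (R : ℝ) : ℝ :=
  ∫ z in Metric.closedBall (0 : ℂ) R, ‖z‖ ^ (2 * k) * Real.exp (-‖z‖ ^ 2)

lemma integral_moment (k : ℕ) :
    ∫ z : ℂ, ‖z‖ ^ (2 * k) * Real.exp (-‖z‖ ^ 2) = Real.pi * k.factorial := by
  have h := Complex.integral_rpow_mul_exp_neg_rpow (p := 2) (q := 2 * k) (by norm_num)
    (by have : (0 : ℝ) ≤ k := k.cast_nonneg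
        linarith)
  rw [show (2 * (k : ℝ) + 2) / 2 = k + 1 by ring, Real.Gamma_nat_eq_factorial] at h
  rw [show Real.pi * (k.factorial : ℝ) = 2 * Real.pi / 2 * k.factorial by ring, ← h]
  refine integral_congr_ae (Eventually.of_forall fun z => ?_)
  simp only [← Real.rpow_natCast]
  push_cast
  rfl

lemma integrable_moment (k : ℕ) :
    Integrable fun z : ℂ => ‖z‖ ^ (2 * k) * Real.exp (-‖z‖ ^ 2) := by
  refine Integrable.of_integral_ne_zero ?_
  rw [integral_moment]
  positivity

lemma discMoment_nonneg (k : ℕ) (R : ℝ) : 0 ≤ discMoment k R :=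
  integral_nonneg fun z => by positivity

lemma discMoment_le (k : ℕ) (R : ℝ) : discMoment k R ≤ Real.pi * k.factorial := by
  rw [← integral_moment]
  exact setIntegral_le_integral (integrable_moment k) (Eventually.of_forall fun z => by positivity)

lemma tendsto_discMoment (k : ℕ) :
    Tendsto (fun N : ℕ => discMoment k N) atTop (nhds (Real.pi * k.factorial)) := by
  rw [← integral_moment]
  exact (aecover_closedBall tendsto_natCast_atTop_atTop).integral_tendsto_of_countably_generated
    (integrable_moment k)

lemma integral_disc_pow (k l : ℕ) (R : ℝ) :
    ∫ z in Metric.closedBall (0 : ℂ) R, z ^ k * (starRingEnd ℂ) (z ^ l) * Real.exp (-‖z‖ ^ 2) =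
      if k = l then (discMoment k R : ℂ) else 0 := by
  split_ifs with hkl
  · subst hkl
    rw [discMoment, ← integral_complex_ofReal]
    refine integral_congr_ae (Eventually.of_forall fun z => ?_)
    simp only [Complex.mul_conj, Complex.normSq_eq_norm_sq, norm_pow]
    push_cast
    ring
  · set J := ∫ z in Metric.closedBall (0 : ℂ) R,
      z ^ k * (starRingEnd ℂ) (z ^ l) * Real.exp (-‖z‖ ^ 2) with hJ
    set t : ℝ := Real.pi / ((k : ℝ) - l) with ht
    have hkl' : ((k : ℝ) - l) ≠ 0 := sub_ne_zero.mpr (by exact_mod_cast hkl)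
    let c : Circle := Circle.exp t
    have hc : (c : ℂ) ^ k * (starRingEnd ℂ) ((c : ℂ) ^ l) = -1 := by
      simp only [c, Circle.coe_exp, ← Complex.exp_conj, ← Complex.exp_nat_mul,
        ← Complex.exp_add, map_mul, Complex.conj_ofReal, Complex.conj_I,
        Complex.conj_natCast]
      rw [← Complex.exp_pi_mul_I]
      congr 1
      have : (t : ℂ) * (k - l) = Real.pi := by
        have : t * (k - l) = Real.pi := div_mul_cancel₀ _ hkl'
        exact_mod_cast this
      linear_combination I * this
    have h := (rotation c).measurePreserving.setIntegral_preimage_emb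
      (rotation c).toHomeomorph.measurableEmbedding
      (fun z : ℂ => z ^ k * (starRingEnd ℂ) (z ^ l) * (Real.exp (-‖z‖ ^ 2) : ℂ))
      (Metric.closedBall 0 R)
    have hpre : (rotation c) ⁻¹' Metric.closedBall (0 : ℂ) R = Metric.closedBall 0 R := by
      ext z
      simp only [Set.mem_preimage, mem_closedBall_zero_iff, LinearIsometryEquiv.norm_map]
    rw [hpre, ← hJ] at h
    have h' : ∀ z : ℂ, (rotation c z) ^ k * (starRingEnd ℂ) ((rotation c z) ^ l) *
        (Real.exp (-‖rotation c z‖ ^ 2) : ℂ) =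
        -1 * (z ^ k * (starRingEnd ℂ) (z ^ l) * Real.exp (-‖z‖ ^ 2)) := fun z => by
      rw [← hc, LinearIsometryEquiv.norm_map, rotation_apply, mul_pow, mul_pow, map_mul]
      ring
    simp only [h', integral_const_mul, ← hJ] at h
    linear_combination (-1 / 2 : ℂ) * h

lemma fWt_eq_prod {n : ℕ} (z : Cn n) : fWt z = ∏ j, Real.exp (-‖z j‖ ^ 2) := by
  rw [fWt, ← Finset.sum_neg_distrib, Real.exp_sum]

lemma fWt_pos {n : ℕ} (z : Cn n) : 0 < fWt z := Real.exp_pos _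

lemma continuous_fWt {n : ℕ} : Continuous (fWt : Cn n → ℝ) := by
  unfold fWt; fun_prop

/-- The squared norm of the monomial `z^α` on a polydisc. -/
def polyMoment {n : ℕ} (α : Fin n → ℕ) (R : ℝ) : ℝ := ∏ j, discMoment (α j) R

/-- The squared norm of the monomial `z^α` in the Fock space. -/
def monoWt {n : ℕ} (α : Fin n → ℕ) : ℝ := ∏ j, (Real.pi * (α j).factorial)

lemma monoWt_pos {n : ℕ} (α : Fin n → ℕ) : 0 < monoWt α :=
  Finset.prod_pos fun j _ => by positivity

lemma polyMoment_nonneg {n : ℕ} (α : Fin n → ℕ) (R : ℝ) : 0 ≤ polyMoment α R :=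
  Finset.prod_nonneg fun _ _ => discMoment_nonneg _ _

lemma polyMoment_le {n : ℕ} (α : Fin n → ℕ) (R : ℝ) : polyMoment α R ≤ monoWt α :=
  Finset.prod_le_prod (fun _ _ => discMoment_nonneg _ _) fun _ _ => discMoment_le _ _

lemma tendsto_polyMoment {n : ℕ} (α : Fin n → ℕ) :
    Tendsto (fun N : ℕ => polyMoment α N) atTop (nhds (monoWt α)) :=
  tendsto_finsetProd _ fun j _ => tendsto_discMoment (α j)

lemma integral_mono_mul_conj {n : ℕ} (α β : Fin n → ℕ) {R : ℝ} (hR : 0 ≤ R) :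
    ∫ z in Metric.closedBall (0 : Cn n) R, mono α z * ((starRingEnd ℂ) (mono β z) * fWt z) =
      if α = β then (polyMoment α R : ℂ) else 0 := by
  have h1 : ∀ z : Cn n, mono α z * ((starRingEnd ℂ) (mono β z) * fWt z) =
      ∏ j, z j ^ α j * (starRingEnd ℂ) (z j ^ β j) * (Real.exp (-‖z j‖ ^ 2) : ℂ) := fun z => by
    rw [fWt_eq_prod, mono, mono, map_prod, Finset.prod_mul_distrib, Finset.prod_mul_distrib]
    push_cast
    ring
  simp only [h1]
  rw [closedBall_pi _ hR, volume_pi, Measure.restrict_pi_pi]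
  rw [integral_fintype_prod_eq_prod (𝕜 := ℂ)
    (f := fun j (w : ℂ) => w ^ α j * (starRingEnd ℂ) (w ^ β j) * (Real.exp (-‖w‖ ^ 2) : ℂ))]
  simp only [Pi.zero_apply, integral_disc_pow]
  split_ifs with h
  · subst h
    simp [polyMoment]
  · obtain ⟨j, hj⟩ := Function.ne_iff.mp h
    exact Finset.prod_eq_zero (mem_univ j) (if_neg hj)

/-- Termwise integration of a power series over a polydisc. -/
lemma HasCoeff.hasSum_integral {n : ℕ} {f : Cn n → ℂ} {a : (Fin n → ℕ) → ℂ} (hf : HasCoeff f a)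
    {h : Cn n → ℂ} (hh : Continuous h) {R : ℝ} (hR : 0 ≤ R) :
    HasSum (fun α => a α * ∫ z in Metric.closedBall (0 : Cn n) R, mono α z * h z)
      (∫ z in Metric.closedBall (0 : Cn n) R, f z * h z) := by
  have hi : ∀ g : Cn n → ℂ, Continuous g → IntegrableOn g (Metric.closedBall (0 : Cn n) R) :=
    fun g hg => hg.continuousOn.integrableOn_compact (isCompact_closedBall 0 R)
  have hint_on : ∀ α, IntegrableOn (fun z => a α * (mono α z * h z)) (Metric.closedBall (0 : Cn n) R) :=
    fun α => hi _ (continuous_const.mul ((differentiable_mono α).continuous.mul hh))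
  have key := hasSum_integral_of_summable_integral_norm
    (μ := volume.restrict (Metric.closedBall (0 : Cn n) R))
    (F := fun α z => a α * (mono α z * h z)) hint_on ?_
  · simp only [integral_const_mul] at key
    convert! key using 1
    refine integral_congr_ae (Eventually.of_forall fun z => ?_)
    simp only [← mul_assoc]
    rw [tsum_mul_right, (hf z).tsum_eq]
  · refine Summable.of_nonneg_of_le (fun α => integral_nonneg fun z => norm_nonneg _) (fun α => ?_)
      ((hf.summable_norm hR).mul_right (∫ z in Metric.closedBall (0 : Cn n) R, ‖h z‖))
    rw [← integral_const_mul]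
    refine setIntegral_mono_on (hint_on α).norm ((hi h hh).norm.const_mul _)
      measurableSet_closedBall fun z hz => ?_
    rw [norm_mul, norm_mul, ← mul_assoc]
    gcongr
    exact norm_mono_le α (by simpa using hz)

lemma continuous_conj_mul_fWt {n : ℕ} {g : Cn n → ℂ} (hg : Continuous g) :
    Continuous fun z => (starRingEnd ℂ) (g z) * (fWt z : ℂ) :=
  (Complex.continuous_conj.comp hg).mul (Complex.continuous_ofReal.comp continuous_fWt)

lemma HasCoeff.integral_mul_conj_mono {n : ℕ} {f : Cn n → ℂ} {a : (Fin n → ℕ) → ℂ}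
    (hf : HasCoeff f a) (β : Fin n → ℕ) {R : ℝ} (hR : 0 ≤ R) :
    ∫ z in Metric.closedBall (0 : Cn n) R, f z * ((starRingEnd ℂ) (mono β z) * fWt z) =
      a β * polyMoment β R := by
  have h := hf.hasSum_integral (continuous_conj_mul_fWt (differentiable_mono β).continuous) hR
  simp only [integral_mono_mul_conj _ _ hR] at h
  refine h.unique ?_
  simpa using hasSum_single (f := fun α => a α * if α = β then (polyMoment α R : ℂ) else 0) β
    fun α hα => by simp [hα]

/-- Parseval's identity on a polydisc. -/
lemma HasCoeff.hasSum_integral_mul_conj {n : ℕ} {f g : Cn n → ℂ} {a b : (Fin n → ℕ) → ℂ}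
    (hf : HasCoeff f a) (hg : HasCoeff g b) {R : ℝ} (hR : 0 ≤ R) :
    HasSum (fun α => a α * (starRingEnd ℂ) (b α) * polyMoment α R)
      (∫ z in Metric.closedBall (0 : Cn n) R, f z * (starRingEnd ℂ) (g z) * fWt z) := by
  have h := hf.hasSum_integral (continuous_conj_mul_fWt hg.differentiable.continuous) hR
  simp only [← mul_assoc] at h
  refine h.congr_fun fun α => ?_
  have h1 := congrArg (starRingEnd ℂ) (hg.integral_mul_conj_mono α hR)
  rw [← integral_conj] at h1
  simp only [map_mul, Complex.conj_conj, Complex.conj_ofReal] at h1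
  rw [mul_assoc, ← h1]
  congr 2
  funext z
  ring

lemma HasCoeff.unique {n : ℕ} {f : Cn n → ℂ} {a b : (Fin n → ℕ) → ℂ}
    (ha : HasCoeff f a) (hb : HasCoeff f b) : a = b := by
  funext β
  have h : ∀ c, HasCoeff f c → Tendsto (fun N : ℕ => ∫ z in Metric.closedBall (0 : Cn n) N,
      f z * ((starRingEnd ℂ) (mono β z) * fWt z)) atTop (nhds (c β * monoWt β)) := fun c hc => by
    simp only [hc.integral_mul_conj_mono β (Nat.cast_nonneg _)]
    exact ((Complex.continuous_ofReal.tendsto _).comp (tendsto_polyMoment β)).const_mul _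
  have := tendsto_nhds_unique (h a ha) (h b hb)
  exact mul_right_cancel₀ (by exact_mod_cast (monoWt_pos β).ne') this

lemma HasCoeff.hasSum_integral_normSq {n : ℕ} {f : Cn n → ℂ} {a : (Fin n → ℕ) → ℂ}
    (hf : HasCoeff f a) {R : ℝ} (hR : 0 ≤ R) :
    HasSum (fun α => ‖a α‖ ^ 2 * polyMoment α R)
      (∫ z in Metric.closedBall (0 : Cn n) R, ‖f z‖ ^ 2 * fWt z) := by
  rw [← Complex.hasSum_ofReal, ← integral_complex_ofReal]
  have h := hf.hasSum_integral_mul_conj hf hR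
  simp only [Complex.mul_conj, Complex.normSq_eq_norm_sq] at h
  simpa only [Complex.ofReal_mul] using h

lemma MemF.sum_le {n : ℕ} {f : Cn n → ℂ} {a : (Fin n → ℕ) → ℂ} (hf : MemF f)
    (ha : HasCoeff f a) (s : Finset (Fin n → ℕ)) :
    ∑ α ∈ s, ‖a α‖ ^ 2 * monoWt α ≤ fNormSq f := by
  have h1 : Tendsto (fun N : ℕ => ∑ α ∈ s, ‖a α‖ ^ 2 * polyMoment α N) atTop
      (nhds (∑ α ∈ s, ‖a α‖ ^ 2 * monoWt α)) :=
    tendsto_finsetSum _ fun α _ => (tendsto_polyMoment α).const_mul _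
  refine le_of_tendsto' h1 fun N => ?_
  refine (sum_le_hasSum s (fun α _ => mul_nonneg (by positivity) (polyMoment_nonneg α _))
    (ha.hasSum_integral_normSq N.cast_nonneg)).trans ?_
  exact setIntegral_le_integral hf.2
    (Eventually.of_forall fun z => mul_nonneg (by positivity) (fWt_pos z).le)

lemma MemF.summable {n : ℕ} {f : Cn n → ℂ} {a : (Fin n → ℕ) → ℂ} (hf : MemF f)
    (ha : HasCoeff f a) : Summable fun α => ‖a α‖ ^ 2 * monoWt α :=
  summable_of_sum_le (fun α => mul_nonneg (by positivity) (monoWt_pos α).le) (hf.sum_le ha)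

lemma HasCoeff.memF {n : ℕ} {f : Cn n → ℂ} {a : (Fin n → ℕ) → ℂ} (ha : HasCoeff f a)
    (hs : Summable fun α => ‖a α‖ ^ 2 * monoWt α) : MemF f := by
  have hc := ha.differentiable.continuous
  refine ⟨ha.differentiable, ?_⟩
  refine (aecover_closedBall (x := (0 : Cn n)) (μ := volume)
    tendsto_natCast_atTop_atTop).integrable_of_integral_norm_bounded
    (∑' α, ‖a α‖ ^ 2 * monoWt α) (fun N => ?_) (Eventually.of_forall fun N => ?_)
  · exact ((hc.norm.pow 2).mul continuous_fWt).continuousOn.integrableOn_compact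
      (isCompact_closedBall _ _)
  · have h := ha.hasSum_integral_normSq (R := N) N.cast_nonneg
    have h2 : ∀ z : Cn n, ‖‖f z‖ ^ 2 * fWt z‖ = ‖f z‖ ^ 2 * fWt z := fun z =>
      Real.norm_of_nonneg (mul_nonneg (by positivity) (fWt_pos z).le)
    simp only [h2]
    rw [← h.tsum_eq]
    exact h.summable.tsum_le_tsum (fun α => by gcongr; exact polyMoment_le α _) hs

lemma summable_mul_conj {n : ℕ} {a b : (Fin n → ℕ) → ℂ}
    (ha : Summable fun α => ‖a α‖ ^ 2 * monoWt α) (hb : Summable fun α => ‖b α‖ ^ 2 * monoWt α) :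
    Summable fun α => ‖a α‖ * ‖b α‖ * monoWt α := by
  refine Summable.of_nonneg_of_le (fun α => mul_nonneg (by positivity) (monoWt_pos α).le)
    (fun α => ?_) (ha.add hb)
  have := mul_nonneg (sq_nonneg (‖a α‖ - ‖b α‖)) (monoWt_pos α).le
  have h2 := mul_nonneg (mul_nonneg (norm_nonneg (a α)) (norm_nonneg (b α))) (monoWt_pos α).le
  nlinarith

/-- Parseval's identity in the Fock space. -/
lemma MemF.hasSum_fInner {n : ℕ} {f g : Cn n → ℂ} {a b : (Fin n → ℕ) → ℂ} (hf : MemF f)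
    (hg : MemF g) (ha : HasCoeff f a) (hb : HasCoeff g b) :
    HasSum (fun α => a α * (starRingEnd ℂ) (b α) * monoWt α) (fInner f g) := by
  have hs := summable_mul_conj (hf.summable ha) (hg.summable hb)
  have hi : Integrable fun z : Cn n => f z * (starRingEnd ℂ) (g z) * fWt z := by
    refine (hf.2.add hg.2).mono' ?_ (Eventually.of_forall fun z => ?_)
    · exact ((hf.1.continuous.mul (Complex.continuous_conj.comp hg.1.continuous)).mul
        (Complex.continuous_ofReal.comp continuous_fWt)).aestronglyMeasurable
    · rw [norm_mul, norm_mul, RCLike.norm_conj, Complex.norm_real, Real.norm_of_nonneg (fWt_pos z).le]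
      have := mul_nonneg (sq_nonneg (‖f z‖ - ‖g z‖)) (fWt_pos z).le
      have h2 := mul_nonneg (mul_nonneg (norm_nonneg (f z)) (norm_nonneg (g z))) (fWt_pos z).le
      simp only [Pi.add_apply]
      nlinarith
  have h1 := (aecover_closedBall (x := (0 : Cn n)) (μ := volume)
    tendsto_natCast_atTop_atTop).integral_tendsto_of_countably_generated hi
  have hn : ∀ α, ‖a α * (starRingEnd ℂ) (b α) * (monoWt α : ℂ)‖ = ‖a α‖ * ‖b α‖ * monoWt α :=
    fun α => by
      rw [norm_mul, norm_mul, RCLike.norm_conj, Complex.norm_real,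
        Real.norm_of_nonneg (monoWt_pos α).le]
  have h2 : Tendsto (fun N : ℕ => ∑' α, a α * (starRingEnd ℂ) (b α) * (polyMoment α N : ℂ)) atTop
      (nhds (∑' α, a α * (starRingEnd ℂ) (b α) * (monoWt α : ℂ))) := by
    refine tendsto_tsum_of_dominated_convergence hs (fun α => ?_)
      (Eventually.of_forall fun N α => ?_)
    · exact ((Complex.continuous_ofReal.tendsto _).comp (tendsto_polyMoment α)).const_mul _
    · rw [norm_mul, norm_mul, RCLike.norm_conj, Complex.norm_real,
        Real.norm_of_nonneg (polyMoment_nonneg α _)]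
      gcongr
      exact polyMoment_le α _
  simp only [fun N : ℕ => (ha.hasSum_integral_mul_conj hb (R := N) N.cast_nonneg).tsum_eq] at h2
  rw [fInner, tendsto_nhds_unique h1 h2]
  refine Summable.hasSum (Summable.of_norm ?_)
  simpa only [hn] using hs

lemma norm_mono_sq_le {n : ℕ} (α : Fin n → ℕ) (z : Cn n) :
    ‖mono α z‖ ^ 2 ≤ monoWt α * ∏ j, ((‖z‖ ^ 2) ^ α j / (α j).factorial) := by
  rw [mono, norm_prod, ← Finset.prod_pow, monoWt, ← Finset.prod_mul_distrib]
  refine Finset.prod_le_prod (fun j _ => by positivity) fun j _ => ?_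
  have h2 : ‖z j‖ ^ 2 ≤ ‖z‖ ^ 2 := by gcongr; exact norm_le_pi_norm z j
  calc ‖z j ^ α j‖ ^ 2 = (‖z j‖ ^ 2) ^ α j := by rw [norm_pow]; ring
    _ ≤ (‖z‖ ^ 2) ^ α j := by gcongr
    _ ≤ Real.pi * (‖z‖ ^ 2) ^ α j :=
      le_mul_of_one_le_left (by positivity) (by linarith [Real.pi_gt_three])
    _ = _ := by
      have : ((α j).factorial : ℝ) ≠ 0 := by positivity
      rw [mul_assoc, mul_div_cancel₀ _ this]

lemma mul_le_add_of_sq_le {x m w E : ℝ} (hw : 0 ≤ w) (hE : 0 ≤ E)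
    (h : m ^ 2 ≤ w * E) : x * m ≤ x ^ 2 * w + E := by
  have h1 : 0 ≤ x ^ 2 * w := by positivity
  refine le_of_sq_le_sq ?_ (by positivity)
  have h2 := mul_le_mul_of_nonneg_left h (sq_nonneg x)
  nlinarith [mul_nonneg h1 hE, sq_nonneg (x ^ 2 * w), sq_nonneg E]

lemma summable_prod_pow_div_factorial (n : ℕ) {x : ℝ} (hx : 0 ≤ x) :
    Summable fun α : Fin n → ℕ => ∏ j, (x ^ α j / (α j).factorial) :=
  summable_pi_prod_of_nonneg n (g := fun k => x ^ k / k.factorial) (fun k => by positivity)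
    (Real.summable_pow_div_factorial x)

lemma exists_hasCoeff {n : ℕ} {a : (Fin n → ℕ) → ℂ}
    (hs : Summable fun α => ‖a α‖ ^ 2 * monoWt α) : ∃ f, HasCoeff f a := by
  refine ⟨fun z => ∑' α, a α * mono α z, fun z => Summable.hasSum ?_⟩
  refine Summable.of_norm_bounded
    (hs.add (summable_prod_pow_div_factorial n (sq_nonneg ‖z‖))) fun α => ?_
  rw [norm_mul]
  exact mul_le_add_of_sq_le (monoWt_pos α).le (Finset.prod_nonneg fun j _ => by positivity)
    (norm_mono_sq_le α z)

lemma sgn_mul_self {n : ℕ} (j : Fin n) (J : Finset (Fin n)) : sgn j J * sgn j J = 1 := by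
  rw [sgn, ← mul_pow]; simp

lemma sgn_insert {n : ℕ} (j : Fin n) {i : Fin n} {J : Finset (Fin n)} (hi : i ∉ J) :
    sgn j (insert i J) = (if i < j then -1 else 1) * sgn j J := by
  rw [sgn, sgn, Finset.filter_insert]
  split_ifs with h
  · rw [Finset.card_insert_of_notMem (by simp [hi]), pow_succ']
  · rw [one_mul]

lemma sgn_mul_sgn_insert {n : ℕ} {i j : Fin n} {K : Finset (Fin n)} (hij : i ≠ j) (hi : i ∉ K)
    (hj : j ∉ K) : sgn j K * sgn i (insert j K) = -(sgn i K * sgn j (insert i K)) := by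
  rw [sgn_insert i hj, sgn_insert j hi]
  rcases lt_or_gt_of_ne hij with h | h
  · rw [if_neg h.asymm, if_pos h]; ring
  · rw [if_pos h, if_neg h.asymm]; ring

lemma sgn_insert_mul_sgn_insert {n : ℕ} {i j : Fin n} {K : Finset (Fin n)} (hij : i ≠ j)
    (hi : i ∉ K) (hj : j ∉ K) :
    sgn i (insert j K) * sgn j (insert i K) = -(sgn j K * sgn i K) := by
  rw [sgn_insert i hj, sgn_insert j hi]
  rcases lt_or_gt_of_ne hij with h | h
  · rw [if_neg h.asymm, if_pos h]; ring
  · rw [if_pos h, if_neg h.asymm]; ring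

/-- Families of power series coefficients of the components of a form. -/
abbrev FormCoeff (n : ℕ) := Finset (Fin n) → (Fin n → ℕ) → ℂ

/-- The action of `∂` on power series coefficients. -/
def dA {n : ℕ} (A : FormCoeff n) : FormCoeff n :=
  fun L α => ∑ j, if j ∈ L then sgn j (L.erase j) * cD j (A (L.erase j)) α else 0

/-- The action of `∂*` on power series coefficients. -/
def sA {n : ℕ} (A : FormCoeff n) : FormCoeff n :=
  fun K α => ∑ j, if j ∉ K then sgn j K * cM j (A (insert j K)) α else 0

/-- The inverse of the Laplacian, which acts on `z^α dz_J` as `|α| + |J|`. -/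
def nA {n : ℕ} (A : FormCoeff n) : FormCoeff n :=
  fun J α => A J α / ((∑ i, α i : ℕ) + J.card : ℂ)

lemma cD_sum_ite {n : ℕ} (j : Fin n) (P : Fin n → Prop) [DecidablePred P] (c : Fin n → ℂ)
    (a : Fin n → (Fin n → ℕ) → ℂ) (α : Fin n → ℕ) :
    cD j (fun β => ∑ i, if P i then c i * a i β else 0) α =
      ∑ i, if P i then c i * cD j (a i) α else 0 := by
  simp only [cD, Finset.mul_sum, mul_ite, mul_zero, mul_left_comm]

lemma cM_sum_ite {n : ℕ} (j : Fin n) (P : Fin n → Prop) [DecidablePred P] (c : Fin n → ℂ)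
    (a : Fin n → (Fin n → ℕ) → ℂ) (α : Fin n → ℕ) :
    cM j (fun β => ∑ i, if P i then c i * a i β else 0) α =
      ∑ i, if P i then c i * cM j (a i) α else 0 := by
  simp only [cM]
  split_ifs <;> simp

lemma cD_comm {n : ℕ} (i j : Fin n) (a : (Fin n → ℕ) → ℂ) (α : Fin n → ℕ) :
    cD i (cD j a) α = cD j (cD i a) α := by
  rcases eq_or_ne i j with rfl | h
  · rfl
  · simp only [cD, Pi.add_apply, Pi.single_eq_of_ne h, Pi.single_eq_of_ne h.symm, add_zero]
    rw [add_right_comm]; ring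

lemma single_sub_comm {n : ℕ} {i j : Fin n} (h : i ≠ j) (α : Fin n → ℕ) :
    α + Pi.single i 1 - Pi.single j 1 = α - Pi.single j 1 + Pi.single i 1 := by
  funext k
  rcases eq_or_ne k i with rfl | hk
  · simp [h]
  · simp [hk]

lemma cM_comm {n : ℕ} (i j : Fin n) (a : (Fin n → ℕ) → ℂ) (α : Fin n → ℕ) :
    cM i (cM j a) α = cM j (cM i a) α := by
  rcases eq_or_ne i j with rfl | h
  · rfl
  · simp only [cM, Pi.sub_apply, Pi.single_eq_of_ne h, Pi.single_eq_of_ne h.symm, tsub_zero]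
    rw [tsub_right_comm]
    split_ifs <;> rfl

lemma cD_cM_comm {n : ℕ} {i j : Fin n} (h : i ≠ j) (a : (Fin n → ℕ) → ℂ) (α : Fin n → ℕ) :
    cD i (cM j a) α = cM j (cD i a) α := by
  simp only [cM, cD, Pi.sub_apply, Pi.add_apply, Pi.single_eq_of_ne h, Pi.single_eq_of_ne h.symm,
    tsub_zero, add_zero, single_sub_comm h]
  split_ifs <;> simp

lemma cD_cM_self {n : ℕ} (j : Fin n) (a : (Fin n → ℕ) → ℂ) (α : Fin n → ℕ) :
    cD j (cM j a) α = (α j + 1) * a α := by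
  simp [cM, cD]

lemma cM_cD_self {n : ℕ} (j : Fin n) (a : (Fin n → ℕ) → ℂ) (α : Fin n → ℕ) :
    cM j (cD j a) α = α j * a α := by
  by_cases h : α j = 0
  · simp [cM, h]
  · simp only [cM, cD, h, if_false, sub_single_add h]
    have : 1 ≤ α j := Nat.one_le_iff_ne_zero.mpr h
    simp [Nat.cast_sub this]

lemma sum_eq_zero_of_antisymm {n : ℕ} {T : Fin n → Fin n → ℂ} (h : ∀ i j, T i j = -T j i) :
    ∑ i, ∑ j, T i j = 0 := by
  have h1 : ∑ i, ∑ j, T i j = -∑ i, ∑ j, T i j := by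
    conv_rhs => rw [Finset.sum_comm]
    simp only [← Finset.sum_neg_distrib]
    exact Finset.sum_congr rfl fun i _ => Finset.sum_congr rfl fun j _ => h i j
  exact CharZero.eq_neg_self_iff.mp h1

lemma dA_dA {n : ℕ} (A : FormCoeff n) : dA (dA A) = 0 := by
  funext L α
  have : dA (dA A) L α = ∑ j, ∑ i, if j ∈ L ∧ i ∈ L.erase j then
      sgn j (L.erase j) * sgn i ((L.erase j).erase i) *
        cD j (cD i (A ((L.erase j).erase i))) α else 0 := by
    conv_lhs => unfold dA
    simp only [cD_sum_ite, Finset.mul_sum]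
    refine Finset.sum_congr rfl fun j _ => ?_
    by_cases hj : j ∈ L <;> simp [hj, mul_assoc]
  rw [this]
  refine sum_eq_zero_of_antisymm fun i j => ?_
  by_cases h : i ∈ L ∧ j ∈ L ∧ i ≠ j
  · obtain ⟨hi, hj, hij⟩ := h
    rw [if_pos ⟨hi, by simp [hj, hij.symm]⟩, if_pos ⟨hj, by simp [hi, hij]⟩]
    rw [Finset.erase_right_comm, cD_comm]
    have h1 : L.erase i = insert j ((L.erase j).erase i) := by
      rw [Finset.erase_right_comm, Finset.insert_erase (by simp [hj, hij.symm])]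
    have h2 : L.erase j = insert i ((L.erase j).erase i) := by
      rw [Finset.insert_erase (by simp [hi, hij])]
    have := sgn_mul_sgn_insert (K := (L.erase j).erase i) hij (by simp) (by simp)
    rw [← h1, ← h2] at this
    linear_combination cD j (cD i (A ((L.erase j).erase i))) α * this
  · rw [if_neg, if_neg, neg_zero]
    · simp only [Finset.mem_erase]; tauto
    · simp only [Finset.mem_erase]; rintro ⟨h1, h2, h3⟩; exact h ⟨h1, h3, h2.symm⟩

lemma sA_sA {n : ℕ} (A : FormCoeff n) : sA (sA A) = 0 := by
  funext K α
  have : sA (sA A) K α = ∑ j, ∑ i, if j ∉ K ∧ i ∉ insert j K then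
      sgn j K * sgn i (insert j K) * cM j (cM i (A (insert i (insert j K)))) α else 0 := by
    conv_lhs => unfold sA
    simp only [cM_sum_ite, Finset.mul_sum]
    refine Finset.sum_congr rfl fun j _ => ?_
    by_cases hj : j ∈ K <;> simp [hj, mul_assoc]
  rw [this]
  refine sum_eq_zero_of_antisymm fun i j => ?_
  by_cases h : i ∉ K ∧ j ∉ K ∧ i ≠ j
  · obtain ⟨hi, hj, hij⟩ := h
    rw [if_pos ⟨hi, by simp [hj, hij.symm]⟩, if_pos ⟨hj, by simp [hi, hij]⟩]
    rw [Finset.insert_comm, cM_comm]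
    linear_combination cM j (cM i (A (insert i (insert j K)))) α *
      sgn_mul_sgn_insert hij hi hj
  · rw [if_neg, if_neg, neg_zero]
    · simp only [Finset.mem_insert]; tauto
    · simp only [Finset.mem_insert]; rintro ⟨h1, h2⟩; push Not at h2
      exact h ⟨h1, h2.2, h2.1.symm⟩

/-- `∂∂* + ∂*∂` acts on `z^α dz_J` as multiplication by `|α| + |J|`. -/
lemma dA_sA_add_sA_dA {n : ℕ} (A : FormCoeff n) (J : Finset (Fin n)) (α : Fin n → ℕ) :
    dA (sA A) J α + sA (dA A) J α = ((∑ i, α i : ℕ) + J.card : ℂ) * A J α := by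
  have h1 : dA (sA A) J α = ∑ j, ∑ i, if j ∈ J ∧ i ∉ J.erase j then
      sgn j (J.erase j) * sgn i (J.erase j) *
        cD j (cM i (A (insert i (J.erase j)))) α else 0 := by
    conv_lhs => unfold dA sA
    simp only [cD_sum_ite, Finset.mul_sum]
    refine Finset.sum_congr rfl fun j _ => ?_
    by_cases hj : j ∈ J <;> simp [hj, mul_assoc]
  have h2 : sA (dA A) J α = ∑ j, ∑ i, if i ∉ J ∧ j ∈ insert i J then
      sgn i J * sgn j ((insert i J).erase j) *
        cM i (cD j (A ((insert i J).erase j))) α else 0 := by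
    conv_lhs => unfold dA sA
    simp only [cM_sum_ite, Finset.mul_sum]
    conv_rhs => rw [Finset.sum_comm]
    refine Finset.sum_congr rfl fun i _ => ?_
    by_cases hi : i ∈ J <;> simp [hi, mul_assoc]
  have h3 : ∀ j i, ((if j ∈ J ∧ i ∉ J.erase j then sgn j (J.erase j) * sgn i (J.erase j) *
      cD j (cM i (A (insert i (J.erase j)))) α else 0) +
      if i ∉ J ∧ j ∈ insert i J then sgn i J * sgn j ((insert i J).erase j) *
        cM i (cD j (A ((insert i J).erase j))) α else 0) =
      if i = j then ((α j : ℂ) + if j ∈ J then 1 else 0) * A J α else 0 := by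
    intro j i
    rcases eq_or_ne i j with rfl | hij
    · by_cases hj : i ∈ J
      · simp [hj, cD_cM_self, sgn_mul_self, Finset.insert_erase]
      · simp [hj, cM_cD_self, sgn_mul_self]
    · rw [if_neg hij]
      by_cases h : j ∈ J ∧ i ∉ J
      · obtain ⟨hj, hi⟩ := h
        rw [if_pos ⟨hj, by simp [hi]⟩, if_pos ⟨hi, by simp [hj]⟩,
          Finset.erase_insert_of_ne hij, cD_cM_comm hij.symm]
        have := sgn_insert_mul_sgn_insert (K := J.erase j) hij (by simp [hi]) (by simp)
        rw [Finset.insert_erase hj] at this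
        linear_combination cM i (cD j (A (insert i (J.erase j)))) α * this
      · rw [if_neg, if_neg, add_zero]
        · simp only [Finset.mem_insert]; rintro ⟨h1, h2⟩
          rcases h2 with h2 | h2
          · exact hij h2.symm
          · exact h ⟨h2, h1⟩
        · simp only [Finset.mem_erase]; rintro ⟨h1, h2⟩
          exact h ⟨h1, fun h3 => h2 ⟨hij, h3⟩⟩
  rw [h1, h2, ← Finset.sum_add_distrib]
  simp only [← Finset.sum_add_distrib, h3]
  simp [← Finset.sum_mul, Finset.sum_add_distrib]

lemma sum_add_single {n : ℕ} (j : Fin n) (α : Fin n → ℕ) :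
    ∑ i, (α + Pi.single j 1 : Fin n → ℕ) i = ∑ i, α i + 1 := by
  simp [Finset.sum_add_distrib]

lemma sum_sub_single {n : ℕ} {j : Fin n} {α : Fin n → ℕ} (h : α j ≠ 0) :
    ∑ i, α i = ∑ i, (α - Pi.single j 1 : Fin n → ℕ) i + 1 := by
  rw [← sum_add_single j, sub_single_add h]

lemma dA_nA {n : ℕ} (A : FormCoeff n) : dA (nA A) = nA (dA A) := by
  funext L α
  simp only [dA, nA, Finset.sum_div]
  refine Finset.sum_congr rfl fun j _ => ?_
  split_ifs with hj
  · have hc : L.card = (L.erase j).card + 1 := (Finset.card_erase_add_one hj).symm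
    simp only [cD, nA, sum_add_single, hc]
    push_cast
    rw [add_right_comm, ← add_assoc]
    ring
  · simp

lemma sA_nA {n : ℕ} (A : FormCoeff n) : sA (nA A) = nA (sA A) := by
  funext K α
  simp only [sA, nA, Finset.sum_div]
  refine Finset.sum_congr rfl fun j _ => ?_
  split_ifs with hj
  · simp
  · simp only [cM]
    split_ifs with h
    · simp
    · rw [nA, sum_sub_single h, Finset.card_insert_of_notMem hj]
      push_cast
      rw [add_right_comm, ← add_assoc]
      ring

lemma dA_zero {n : ℕ} : dA (0 : FormCoeff n) = 0 := by
  funext L α; simp [dA, cD]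

lemma sA_zero {n : ℕ} : sA (0 : FormCoeff n) = 0 := by
  funext L α; simp [sA, cM]

lemma nA_zero {n : ℕ} : nA (0 : FormCoeff n) = 0 := by
  funext L α; simp [nA]

lemma mul_nA {n : ℕ} {V : FormCoeff n} (h0 : V ∅ 0 = 0) (J : Finset (Fin n)) (α : Fin n → ℕ) :
    ((∑ i, α i : ℕ) + J.card : ℂ) * nA V J α = V J α := by
  rw [nA]
  by_cases hc : ((∑ i, α i : ℕ) + J.card : ℂ) = 0
  · have : (∑ i, α i) + J.card = 0 := by exact_mod_cast hc
    have h1 : J = ∅ := by rw [← Finset.card_eq_zero]; omega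
    have h2 : α = 0 := by
      funext i
      have := Finset.single_le_sum (f := α) (fun _ _ => Nat.zero_le _) (Finset.mem_univ i)
      simp only [Pi.zero_apply]; omega
    rw [hc, h1, h2, h0]; simp
  · rw [mul_div_cancel₀ _ hc]

lemma dA_sA_nA {n : ℕ} {V : FormCoeff n} (hV : dA V = 0) (h0 : V ∅ 0 = 0) :
    dA (sA (nA V)) = V := by
  funext J α
  have h := dA_sA_add_sA_dA (nA V) J α
  rwa [dA_nA, hV, nA_zero, sA_zero, mul_nA h0, Pi.zero_apply, Pi.zero_apply, add_zero] at h

lemma sA_dA_nA {n : ℕ} {W : FormCoeff n} (hW : sA W = 0) (h0 : W ∅ 0 = 0) :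
    sA (dA (nA W)) = W := by
  funext J α
  have h := dA_sA_add_sA_dA (nA W) J α
  rwa [sA_nA, hW, nA_zero, dA_zero, mul_nA h0, Pi.zero_apply, Pi.zero_apply, zero_add] at h

lemma HasCoeff.sum {n : ℕ} {ι : Type*} {s : Finset ι} {f : ι → Cn n → ℂ}
    {a : ι → (Fin n → ℕ) → ℂ} (h : ∀ i ∈ s, HasCoeff (f i) (a i)) :
    HasCoeff (fun z => ∑ i ∈ s, f i z) (fun α => ∑ i ∈ s, a i α) := by
  intro z
  simp only [Finset.sum_mul]
  exact hasSum_sum fun i hi => h i hi z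

lemma HasCoeff.const_mul {n : ℕ} {f : Cn n → ℂ} {a : (Fin n → ℕ) → ℂ} (h : HasCoeff f a) (c : ℂ) :
    HasCoeff (fun z => c * f z) (fun α => c * a α) := by
  intro z
  simp only [mul_assoc]
  exact (h z).mul_left c

lemma HasCoeff.sub {n : ℕ} {f g : Cn n → ℂ} {a b : (Fin n → ℕ) → ℂ} (hf : HasCoeff f a)
    (hg : HasCoeff g b) : HasCoeff (fun z => f z - g z) (fun α => a α - b α) := by
  intro z
  simp only [sub_mul]
  exact (hf z).sub (hg z)

lemma hasCoeff_zero {n : ℕ} : HasCoeff (0 : Cn n → ℂ) 0 := by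
  intro z
  simp

lemma HasCoeff.eq_of_coeff {n : ℕ} {f g : Cn n → ℂ} {a : (Fin n → ℕ) → ℂ} (hf : HasCoeff f a)
    (hg : HasCoeff g a) : f = g :=
  funext fun z => (hf z).unique (hg z)

lemma hasCoeff_dOp {n : ℕ} {u : FormC n} {A : FormCoeff n} (h : ∀ J, HasCoeff (u J) (A J))
    (L : Finset (Fin n)) : HasCoeff (dOp u L) (dA A L) := by
  have e : dA A L = fun α => ∑ j ∈ L, sgn j (L.erase j) * cD j (A (L.erase j)) α := by
    funext α; simp [dA, Finset.sum_ite_mem]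
  rw [e]
  exact HasCoeff.sum fun j _ => ((h (L.erase j)).pdz j).const_mul (sgn j (L.erase j))

lemma hasCoeff_dStarOp {n : ℕ} {u : FormC n} {A : FormCoeff n} (h : ∀ J, HasCoeff (u J) (A J))
    (K : Finset (Fin n)) : HasCoeff (dStarOp u K) (sA A K) := by
  have e : sA A K = fun α => ∑ j ∈ Kᶜ, sgn j K * cM j (A (insert j K)) α := by
    funext α
    simp only [sA, ← Finset.mem_compl, Finset.sum_ite_mem, Finset.univ_inter]
  rw [e]
  exact HasCoeff.sum fun j _ => ((h (insert j K)).mul_coord j).const_mul (sgn j K)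

lemma MemA2.exists_coeff {n : ℕ} {u : FormC n} (hu : MemA2 u) :
    ∃ A : FormCoeff n, ∀ J, HasCoeff (u J) (A J) := by
  choose A hA using fun J => exists_hasCoeff_cauchy (hu J).1
  exact ⟨A, fun J => (hA J).1⟩

lemma summable_sq_sum {n : ℕ} {w : (Fin n → ℕ) → ℝ} (hw : ∀ α, 0 ≤ w α) {ι : Type*}
    {s : Finset ι} {a : ι → (Fin n → ℕ) → ℂ}
    (h : ∀ i ∈ s, Summable fun α => ‖a i α‖ ^ 2 * w α) :
    Summable fun α => ‖∑ i ∈ s, a i α‖ ^ 2 * w α := by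
  refine Summable.of_nonneg_of_le (fun α => mul_nonneg (by positivity) (hw α)) (fun α => ?_)
    ((summable_sum h).mul_left (s.card : ℝ))
  rw [← Finset.sum_mul, ← mul_assoc]
  refine mul_le_mul_of_nonneg_right ?_ (hw α)
  refine (pow_le_pow_left₀ (norm_nonneg _) (norm_sum_le _ _) 2).trans ?_
  exact sq_sum_le_card_mul_sum_sq

lemma norm_sgn {n : ℕ} (j : Fin n) (J : Finset (Fin n)) : ‖sgn j J‖ = 1 := by
  simp [sgn]

lemma monoWt_add_single {n : ℕ} (j : Fin n) (α : Fin n → ℕ) :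
    monoWt (α + Pi.single j 1) = (α j + 1) * monoWt α := by
  simp only [monoWt]
  rw [← Finset.mul_prod_erase _ _ (Finset.mem_univ j), ← Finset.mul_prod_erase univ
    (fun j => Real.pi * ((α j).factorial : ℝ)) (Finset.mem_univ j)]
  have : ∏ i ∈ univ.erase j, (Real.pi * (((α + Pi.single j 1 : Fin n → ℕ) i).factorial : ℝ)) =
      ∏ i ∈ univ.erase j, (Real.pi * ((α i).factorial : ℝ)) :=
    Finset.prod_congr rfl fun i hi => by simp [Finset.ne_of_mem_erase hi]
  rw [this]
  simp [Nat.factorial_succ]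
  ring

lemma summable_cM_div {n : ℕ} {b : (Fin n → ℕ) → ℂ} (hb : Summable fun α => ‖b α‖ ^ 2 * monoWt α)
    {k : ℕ} (hk : 1 ≤ k) (j : Fin n) :
    Summable fun α => ‖cM j (fun β => b β / ((∑ i, β i : ℕ) + k : ℂ)) α‖ ^ 2 *
      (((∑ i, α i : ℕ) : ℝ) * monoWt α) := by
  rw [← (add_left_injective (Pi.single j 1)).summable_iff]
  · refine Summable.of_nonneg_of_le (fun α => ?_) (fun α => ?_) hb
    · exact mul_nonneg (by positivity) (mul_nonneg (by positivity) (monoWt_pos _).le)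
    · have h1 : ‖((∑ i, α i : ℕ) + k : ℂ)‖ = ((∑ i, α i : ℕ) : ℝ) + k := by
        exact_mod_cast Complex.norm_natCast _
      have hS : (α j : ℝ) ≤ (∑ i, α i : ℕ) := by
        exact_mod_cast Finset.single_le_sum (f := α) (fun _ _ => Nat.zero_le _) (Finset.mem_univ j)
      have hk' : (1 : ℝ) ≤ k := by exact_mod_cast hk
      simp only [Function.comp, cM, sum_add_single, monoWt_add_single]
      simp only [Pi.add_apply, Pi.single_eq_same, Nat.succ_ne_zero, if_false, add_tsub_cancel_right,
        norm_div, h1, Nat.cast_add, Nat.cast_one]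
      generalize ((∑ i, α i : ℕ) : ℝ) = S at *
      have hα : (0 : ℝ) ≤ α j := by positivity
      have hpos : 0 < (S + k) ^ 2 := by nlinarith
      rw [div_pow, div_mul_eq_mul_div, div_le_iff₀ hpos, mul_assoc]
      refine mul_le_mul_of_nonneg_left ?_ (by positivity)
      rw [← mul_assoc, mul_comm (monoWt α)]
      refine mul_le_mul_of_nonneg_right ?_ (monoWt_pos α).le
      nlinarith
  · intro α hα
    simp [cM, mem_range_add_single hα]

lemma summable_cD_of_summable {n : ℕ} {b : (Fin n → ℕ) → ℂ}
    (hb : Summable fun α => ‖b α‖ ^ 2 * (((∑ i, α i : ℕ) : ℝ) * monoWt α)) (j : Fin n) :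
    Summable fun α => ‖cD j b α‖ ^ 2 * monoWt α := by
  refine Summable.of_nonneg_of_le (fun α => mul_nonneg (by positivity) (monoWt_pos _).le)
    (fun α => ?_) (hb.comp_injective (add_left_injective (Pi.single j 1)))
  have h1 : ‖(α j + 1 : ℂ)‖ = α j + 1 := by exact_mod_cast Complex.norm_natCast (α j + 1)
  have hS : (α j : ℝ) ≤ (∑ i, α i : ℕ) := by
    exact_mod_cast Finset.single_le_sum (f := α) (fun _ _ => Nat.zero_le _) (Finset.mem_univ j)
  simp only [Function.comp, cD, sum_add_single, monoWt_add_single, norm_mul, h1]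
  push_cast at hS ⊢
  have : 0 ≤ ‖b (α + Pi.single j 1)‖ ^ 2 * (α j + 1) * monoWt α :=
    mul_nonneg (by positivity) (monoWt_pos α).le
  nlinarith [mul_le_mul_of_nonneg_right hS this]

lemma summable_cD_div {n : ℕ} {b : (Fin n → ℕ) → ℂ} (hb : Summable fun α => ‖b α‖ ^ 2 * monoWt α)
    (k : ℕ) (j : Fin n) :
    Summable fun α => ‖cD j (fun β => b β / ((∑ i, β i : ℕ) + k : ℂ)) α‖ ^ 2 * monoWt α := by
  refine summable_cD_of_summable (Summable.of_nonneg_of_le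
    (fun α => mul_nonneg (by positivity) (mul_nonneg (by positivity) (monoWt_pos _).le))
    (fun α => ?_) hb) j
  have h1 : ‖((∑ i, α i : ℕ) + k : ℂ)‖ = ((∑ i, α i : ℕ) + k : ℕ) := by
    exact_mod_cast Complex.norm_natCast _
  rw [norm_div, h1, div_pow, ← mul_assoc]
  refine mul_le_mul_of_nonneg_right ?_ (monoWt_pos α).le
  rw [div_mul_eq_mul_div]
  refine div_le_of_le_mul₀ (by positivity) (by positivity) ?_
  gcongr
  have : ∑ i, α i ≤ ((∑ i, α i) + k) ^ 2 :=
    (Nat.le_add_right _ k).trans (Nat.le_self_pow two_ne_zero _)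
  exact_mod_cast this

lemma summable_sA_nA {n : ℕ} {V : FormCoeff n}
    (hV : ∀ J, Summable fun α => ‖V J α‖ ^ 2 * monoWt α) (K : Finset (Fin n)) :
    Summable fun α => ‖sA (nA V) K α‖ ^ 2 * (((∑ i, α i : ℕ) : ℝ) * monoWt α) := by
  refine summable_sq_sum (fun α => mul_nonneg (by positivity) (monoWt_pos _).le) fun j _ => ?_
  split_ifs with hj
  · simp
  · simp only [norm_mul, norm_sgn, one_mul]
    exact summable_cM_div (hV _) (Finset.card_pos.mpr ⟨j, by simp⟩) j

lemma sA_apply_zero {n : ℕ} (A : FormCoeff n) (K : Finset (Fin n)) : sA A K 0 = 0 := by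
  simp [sA, cM]

lemma summable_of_summable_mul_sum {n : ℕ} {b : (Fin n → ℕ) → ℂ} (h0 : b 0 = 0)
    (hb : Summable fun α => ‖b α‖ ^ 2 * (((∑ i, α i : ℕ) : ℝ) * monoWt α)) :
    Summable fun α => ‖b α‖ ^ 2 * monoWt α := by
  refine Summable.of_nonneg_of_le (fun α => mul_nonneg (by positivity) (monoWt_pos _).le)
    (fun α => ?_) hb
  rcases eq_or_ne α 0 with rfl | hα
  · simp [h0]
  · have h1 : 1 ≤ ∑ i, α i := by
      rw [Nat.one_le_iff_ne_zero]
      exact fun h => hα (funext fun i => (Finset.sum_eq_zero_iff.mp h) i (Finset.mem_univ i))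
    gcongr
    exact le_mul_of_one_le_left (monoWt_pos α).le (by exact_mod_cast h1)

lemma summable_dA {n : ℕ} {A : FormCoeff n}
    (hA : ∀ j J, Summable fun α => ‖cD j (A J) α‖ ^ 2 * monoWt α) (L : Finset (Fin n)) :
    Summable fun α => ‖dA A L α‖ ^ 2 * monoWt α := by
  refine summable_sq_sum (fun α => (monoWt_pos _).le) fun j _ => ?_
  split_ifs with hj
  · simpa only [norm_mul, norm_sgn, one_mul] using hA j _
  · simp

lemma conj_sgn {n : ℕ} (j : Fin n) (J : Finset (Fin n)) : (starRingEnd ℂ) (sgn j J) = sgn j J := by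
  simp [sgn]

/-- Differentiation and multiplication by the coordinate are adjoint in the Fock space. -/
lemma hasSum_cM_iff {n : ℕ} (j : Fin n) {a b : (Fin n → ℕ) → ℂ} {s : ℂ} :
    HasSum (fun α => cM j a α * (starRingEnd ℂ) (b α) * monoWt α) s ↔
      HasSum (fun α => a α * (starRingEnd ℂ) (cD j b α) * monoWt α) s := by
  rw [← (add_left_injective (Pi.single j 1)).hasSum_iff]
  · refine iff_of_eq (congrArg (HasSum · s) (funext fun α => ?_))
    simp only [Function.comp, cM, cD, monoWt_add_single]
    simp
    ring
  · intro α hα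
    simp [cM, mem_range_add_single hα]

lemma sum_insert_eq_sum_erase {n : ℕ} (j : Fin n) (f : Finset (Fin n) → ℂ) :
    (∑ K : Finset (Fin n), if j ∉ K then f (insert j K) else 0) =
      ∑ L : Finset (Fin n), if j ∈ L then f L else 0 := by
  rw [← Finset.sum_filter, ← Finset.sum_filter]
  refine Finset.sum_nbij' (fun K => insert j K) (fun L => L.erase j) ?_ ?_ ?_ ?_ ?_
  · simp
  · simp
  · intro K hK; exact Finset.erase_insert (by simpa using hK)
  · intro L hL; exact Finset.insert_erase (by simpa using hL)
  · simp

/-- `∂` and `∂*` are adjoint to each other, in terms of power series coefficients. -/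
lemma exists_hasSum_adjoint {n : ℕ} {U X : FormCoeff n}
    (hU : ∀ L, Summable fun α => ‖U L α‖ ^ 2 * monoWt α)
    (hX : ∀ j K, Summable fun α => ‖cD j (X K) α‖ ^ 2 * monoWt α) :
    ∃ s : ℂ, HasSum (fun α => ∑ L, U L α * (starRingEnd ℂ) (dA X L α) * monoWt α) s ∧
      HasSum (fun α => ∑ K, sA U K α * (starRingEnd ℂ) (X K α) * monoWt α) s := by
  have ht : ∀ L j, ∃ t, HasSum (fun α => U L α * (starRingEnd ℂ) (cD j (X (L.erase j)) α) *
      monoWt α) t := by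
    intro L j
    refine Summable.of_norm ?_
    refine (summable_mul_conj (hU L) (hX j (L.erase j))).congr fun α => ?_
    rw [norm_mul, norm_mul, RCLike.norm_conj, Complex.norm_real,
      Real.norm_of_nonneg (monoWt_pos α).le]
  choose t ht using ht
  refine ⟨∑ L, ∑ j, if j ∈ L then sgn j (L.erase j) * t L j else 0, ?_, ?_⟩
  · refine hasSum_sum fun L _ => ?_
    have : ∀ α, U L α * (starRingEnd ℂ) (dA X L α) * monoWt α = ∑ j, if j ∈ L then
        sgn j (L.erase j) * (U L α * (starRingEnd ℂ) (cD j (X (L.erase j)) α) * monoWt α)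
        else 0 := by
      intro α
      simp only [dA, map_sum, Finset.mul_sum, Finset.sum_mul]
      refine Finset.sum_congr rfl fun j _ => ?_
      split_ifs
      · rw [map_mul, conj_sgn]; ring
      · simp
    simp only [this]
    refine hasSum_sum fun j _ => ?_
    split_ifs
    · exact (ht L j).mul_left _
    · exact hasSum_zero
  · have hs : (∑ L, ∑ j, if j ∈ L then sgn j (L.erase j) * t L j else 0) =
        ∑ K, ∑ j, if j ∉ K then sgn j K * t (insert j K) j else 0 := by
      rw [Finset.sum_comm]
      conv_rhs => rw [Finset.sum_comm]
      refine Finset.sum_congr rfl fun j _ => ?_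
      rw [← sum_insert_eq_sum_erase j fun L => sgn j (L.erase j) * t L j]
      refine Finset.sum_congr rfl fun K _ => ?_
      split_ifs with hj
      · rfl
      · rw [Finset.erase_insert hj]
    rw [hs]
    refine hasSum_sum fun K _ => ?_
    have : ∀ α, sA U K α * (starRingEnd ℂ) (X K α) * monoWt α = ∑ j, if j ∉ K then
        sgn j K * (cM j (U (insert j K)) α * (starRingEnd ℂ) (X K α) * monoWt α) else 0 := by
      intro α
      simp only [sA, Finset.sum_mul]
      refine Finset.sum_congr rfl fun j _ => ?_
      split_ifs
      · simp
      · ring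
    simp only [this]
    refine hasSum_sum fun j _ => ?_
    split_ifs with hj
    · exact hasSum_zero
    · refine HasSum.mul_left _ ((hasSum_cM_iff j).mpr ?_)
      have := ht (insert j K) j
      rwa [Finset.erase_insert hj] at this

lemma MemF.sub {n : ℕ} {f g : Cn n → ℂ} (hf : MemF f) (hg : MemF g) :
    MemF fun z => f z - g z := by
  refine ⟨hf.1.sub hg.1, ?_⟩
  refine ((hf.2.add hg.2).const_mul 2).mono' ?_ (Eventually.of_forall fun z => ?_)
  · exact (((hf.1.continuous.sub hg.1.continuous).norm.pow 2).mul
      continuous_fWt).aestronglyMeasurable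
  · rw [Real.norm_of_nonneg (mul_nonneg (by positivity) (fWt_pos z).le)]
    simp only [Pi.add_apply]
    rw [← add_mul, ← mul_assoc]
    refine mul_le_mul_of_nonneg_right ?_ (fWt_pos z).le
    have := norm_sub_le (f z) (g z)
    nlinarith [sq_nonneg (‖f z‖ - ‖g z‖), norm_nonneg (f z - g z)]

lemma fNormSq_nonneg {n : ℕ} (f : Cn n → ℂ) : 0 ≤ fNormSq f :=
  integral_nonneg fun z => mul_nonneg (by positivity) (fWt_pos z).le

lemma norm_coeff_sq_le_formNormSq {n : ℕ} {u : FormC n} {A : FormCoeff n} (hu : MemA2 u)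
    (hA : ∀ J, HasCoeff (u J) (A J)) (J : Finset (Fin n)) (α : Fin n → ℕ) :
    ‖A J α‖ ^ 2 * monoWt α ≤ formNormSq u := by
  have h1 := (hu J).sum_le (hA J) {α}
  rw [Finset.sum_singleton] at h1
  exact h1.trans (Finset.single_le_sum (f := fun J => fNormSq (u J))
    (fun J _ => fNormSq_nonneg _) (Finset.mem_univ J))

/-- A coefficientwise closed condition is preserved under limits in the Fock norm. -/
lemma mem_of_forall_formNormSq_lt {n : ℕ} {v : FormC n} {V : FormCoeff n} (hv : MemA2 v)
    (hV : ∀ J, HasCoeff (v J) (V J)) {S : Set (FormCoeff n)} (hS : IsClosed S)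
    (h : ∀ ε : ℝ, 0 < ε → ∃ g : FormC n, ∃ B ∈ S, MemA2 g ∧ (∀ J, HasCoeff (g J) (B J)) ∧
      formNormSq (fun J z => g J z - v J z) < ε) : V ∈ S := by
  choose! g B hBS hg hB hlt using fun k : ℕ => h (1 / ((k : ℝ) + 1)) (by positivity)
  refine hS.mem_of_tendsto (f := B) (b := atTop) ?_ (Eventually.of_forall hBS)
  rw [tendsto_pi_nhds]; intro J
  rw [tendsto_pi_nhds]; intro α
  rw [tendsto_iff_norm_sub_tendsto_zero]
  have hsq : Tendsto (fun k => ‖B k J α - V J α‖ ^ 2) atTop (nhds 0) := by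
    have h0 := tendsto_one_div_add_atTop_nhds_zero_nat (𝕜 := ℝ)
    have h1 := h0.div_const (monoWt α)
    rw [zero_div] at h1
    refine squeeze_zero (fun k => by positivity) (fun k => ?_) h1
    rw [le_div_iff₀ (monoWt_pos α)]
    exact (norm_coeff_sq_le_formNormSq (fun J => (hg k J).sub (hv J))
      (fun J => (hB k J).sub (hV J)) J α).trans (hlt k).le
  simpa [Real.sqrt_sq (norm_nonneg _)] using hsq.sqrt

lemma continuous_dA {n : ℕ} : Continuous (dA : FormCoeff n → FormCoeff n) := by
  refine continuous_pi fun L => continuous_pi fun α => continuous_finsetSum _ fun j _ => ?_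
  split_ifs
  · unfold cD; fun_prop
  · exact continuous_const

lemma continuous_sA {n : ℕ} : Continuous (sA : FormCoeff n → FormCoeff n) := by
  refine continuous_pi fun L => continuous_pi fun α => continuous_finsetSum _ fun j _ => ?_
  unfold cM
  split_ifs <;> fun_prop

lemma IsDeg.coeff_eq_zero {n p : ℕ} {u : FormC n} {A : FormCoeff n} (hu : IsDeg p u)
    (hA : ∀ J, HasCoeff (u J) (A J)) {J : Finset (Fin n)} (hJ : J.card ≠ p) : A J = 0 := by
  have := hA J
  rw [hu J hJ] at this
  exact this.unique hasCoeff_zero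

lemma exists_form_of_coeff {n p : ℕ} {A : FormCoeff n}
    (hA : ∀ J, Summable fun α => ‖A J α‖ ^ 2 * monoWt α)
    (h0 : ∀ J : Finset (Fin n), J.card ≠ p → A J = 0) :
    ∃ u : FormC n, IsDeg p u ∧ MemA2 u ∧ ∀ J, HasCoeff (u J) (A J) := by
  choose u hu using fun J => exists_hasCoeff (hA J)
  refine ⟨u, fun J hJ => ?_, fun J => (hu J).memF (hA J), hu⟩
  have := hu J
  rw [h0 J hJ] at this
  exact this.eq_of_coeff hasCoeff_zero

lemma form_eq_of_coeff {n : ℕ} {u v : FormC n} {A B : FormCoeff n}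
    (hu : ∀ J, HasCoeff (u J) (A J)) (hv : ∀ J, HasCoeff (v J) (B J)) (h : A = B) : u = v := by
  subst h
  exact funext fun J => (hu J).eq_of_coeff (hv J)

lemma sA_eq_zero_of_card {n p : ℕ} {A : FormCoeff n}
    (hA : ∀ J : Finset (Fin n), J.card ≠ p + 1 → A J = 0) (K : Finset (Fin n)) (hK : K.card ≠ p) :
    sA A K = 0 := by
  funext α
  refine Finset.sum_eq_zero fun j _ => ?_
  split_ifs with hj
  · rfl
  · rw [hA _ (by rw [Finset.card_insert_of_notMem hj]; omega)]
    simp [cM]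

lemma dA_eq_zero_of_card {n p : ℕ} {A : FormCoeff n}
    (hA : ∀ J : Finset (Fin n), J.card ≠ p → A J = 0) (L : Finset (Fin n))
    (hL : L.card ≠ p + 1) : dA A L = 0 := by
  funext α
  refine Finset.sum_eq_zero fun j _ => ?_
  split_ifs with hj
  · rw [hA _ (by have := Finset.card_erase_add_one hj; omega)]
    simp [cD]
  · rfl

lemma nA_eq_zero {n : ℕ} {A : FormCoeff n} {J : Finset (Fin n)} (h : A J = 0) : nA A J = 0 := by
  funext α; simp [nA, h]

lemma MemA2.hasSum_formInner {n : ℕ} {u v : FormC n} {U V : FormCoeff n} (hu : MemA2 u)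
    (hv : MemA2 v) (hU : ∀ J, HasCoeff (u J) (U J)) (hV : ∀ J, HasCoeff (v J) (V J)) :
    HasSum (fun α => ∑ J, U J α * (starRingEnd ℂ) (V J α) * monoWt α) (formInner u v) :=
  hasSum_sum fun J _ => (hu J).hasSum_fInner (hv J) (hU J) (hV J)

/-- `ker ∂` is orthogonal to `ker ∂*` in positive degree. -/
lemma formInner_eq_zero {n p : ℕ} {u v : FormC n} (hu : MemA2 u) (hvp : IsDeg (p + 1) v)
    (hv : MemA2 v) (hdu : dStarOp u = 0) (hdv : dOp v = 0) : formInner u v = 0 := by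
  obtain ⟨U, hU⟩ := hu.exists_coeff
  obtain ⟨V, hV⟩ := hv.exists_coeff
  have hsU : sA U = 0 := funext fun K =>
    (hasCoeff_dStarOp hU K).unique (by rw [hdu]; exact hasCoeff_zero)
  have hdV : dA V = 0 := funext fun L =>
    (hasCoeff_dOp hV L).unique (by rw [hdv]; exact hasCoeff_zero)
  have hV0 : V ∅ 0 = 0 := by rw [hvp.coeff_eq_zero hV (by simp)]; rfl
  have hX := summable_sA_nA fun J => (hv J).summable (hV J)
  obtain ⟨s, hs, hs'⟩ := exists_hasSum_adjoint (X := sA (nA V))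
    (fun J => (hu J).summable (hU J)) fun j K => summable_cD_of_summable (hX K) j
  rw [dA_sA_nA hdV hV0] at hs
  simp only [hsU, Pi.zero_apply, zero_mul, Finset.sum_const_zero] at hs'
  rw [(hu.hasSum_formInner hv hU hV).unique hs, hs'.unique hasSum_zero]

/-- A form orthogonal to `ker ∂` lies in `ker ∂*`. -/
lemma dStarOp_eq_zero {n p : ℕ} {u : FormC n} (hup : IsDeg (p + 1) u) (hu : MemA2 u)
    (h : ∀ v : FormC n, IsDeg (p + 1) v → MemA2 v → dOp v = 0 → formInner u v = 0) :
    dStarOp u = 0 := by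
  obtain ⟨U, hU⟩ := hu.exists_coeff
  refine form_eq_of_coeff (hasCoeff_dStarOp hU) (B := 0) (fun J => hasCoeff_zero) ?_
  funext K
  by_cases hK : K.card = p
  swap
  · exact sA_eq_zero_of_card (fun J hJ => hup.coeff_eq_zero hU hJ) K hK
  funext α
  set X : FormCoeff n := Pi.single K (Pi.single α 1) with hX
  have hXD : ∀ j J, Summable fun β => ‖cD j (X J) β‖ ^ 2 * monoWt β := by
    intro j J
    refine summable_of_hasFiniteSupport ?_
    refine ((Set.finite_singleton α).preimage
      (add_left_injective (Pi.single j 1)).injOn).subset fun β hβ => ?_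
    by_contra hne
    refine hβ ?_
    have : β + Pi.single j 1 ≠ α := hne
    rcases eq_or_ne J K with rfl | hJ
    · simp [cD, hX, this]
    · simp [cD, hX, hJ]
  have hX0 : ∀ J : Finset (Fin n), J.card ≠ p → X J = 0 := by
    intro J hJ
    have : J ≠ K := by rintro rfl; exact hJ hK
    simp [hX, this]
  obtain ⟨v, hvp, hv, hV⟩ := exists_form_of_coeff (summable_dA hXD) (dA_eq_zero_of_card hX0)
  have hdv : dOp v = 0 := form_eq_of_coeff (hasCoeff_dOp hV) (B := 0)
    (fun J => hasCoeff_zero) (dA_dA X)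
  obtain ⟨s, hs, hs'⟩ := exists_hasSum_adjoint (fun J => (hu J).summable (hU J)) hXD
  rw [← (hu.hasSum_formInner hv hU hV).unique hs, h v hvp hv hdv] at hs'
  have h1 : HasSum (fun β => ∑ J, sA U J β * (starRingEnd ℂ) (X J β) * monoWt β)
      (sA U K α * monoWt α) := by
    have := hasSum_single (f := fun β => ∑ J, sA U J β * (starRingEnd ℂ) (X J β) * monoWt β) α ?_
    · rw [Finset.sum_eq_single K] at this
      · simpa [hX] using this
      · intro J _ hJ; simp [hX, hJ]
      · simp
    · intro β hβ
      refine Finset.sum_eq_zero fun J _ => ?_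
      rcases eq_or_ne J K with rfl | hJ
      · simp [hX, hβ]
      · simp [hX, hJ]
  have h2 := h1.unique hs'
  have h3 : (monoWt α : ℂ) ≠ 0 := by exact_mod_cast (monoWt_pos α).ne'
  simpa [h3] using h2

/-- `∂` has closed range. -/
lemma exists_dOp_eq {n p : ℕ} {v : FormC n} (hvp : IsDeg (p + 1) v) (hv : MemA2 v)
    (h : ∀ ε : ℝ, 0 < ε → ∃ u : FormC n, IsDeg p u ∧ domD u ∧
      formNormSq (fun J z => dOp u J z - v J z) < ε) :
    ∃ u : FormC n, IsDeg p u ∧ domD u ∧ dOp u = v := by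
  obtain ⟨V, hV⟩ := hv.exists_coeff
  have hdV : dA V = 0 := by
    refine mem_of_forall_formNormSq_lt hv hV (S := {B | dA B = 0})
      (isClosed_eq continuous_dA continuous_const) fun ε hε => ?_
    obtain ⟨u, -, hu, hlt⟩ := h ε hε
    obtain ⟨U, hU⟩ := hu.1.exists_coeff
    exact ⟨dOp u, dA U, dA_dA U, hu.2, hasCoeff_dOp hU, hlt⟩
  have hV0 : V ∅ 0 = 0 := by rw [hvp.coeff_eq_zero hV (by simp)]; rfl
  have hs := summable_sA_nA fun J => (hv J).summable (hV J)
  obtain ⟨u, hup, hu, hU⟩ := exists_form_of_coeff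
    (fun J => summable_of_summable_mul_sum (sA_apply_zero _ _) (hs J))
    (sA_eq_zero_of_card fun J hJ => nA_eq_zero (hvp.coeff_eq_zero hV hJ))
  have hd : dOp u = v := form_eq_of_coeff (hasCoeff_dOp hU) hV (dA_sA_nA hdV hV0)
  exact ⟨u, hup, ⟨hu, hd ▸ hv⟩, hd⟩

/-- `∂*` has closed range. -/
lemma exists_dStarOp_eq {n p : ℕ} {w : FormC n} (hwp : IsDeg p w) (hw : MemA2 w)
    (h : ∀ ε : ℝ, 0 < ε → ∃ u : FormC n, IsDeg (p + 1) u ∧ domDs u ∧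
      formNormSq (fun J z => dStarOp u J z - w J z) < ε) :
    ∃ u : FormC n, IsDeg (p + 1) u ∧ domDs u ∧ dStarOp u = w := by
  obtain ⟨W, hW⟩ := hw.exists_coeff
  have hsW : sA W = 0 ∧ W ∅ 0 = 0 := by
    refine mem_of_forall_formNormSq_lt hw hW (S := {B | sA B = 0 ∧ B ∅ 0 = 0})
      ((isClosed_eq continuous_sA continuous_const).inter
        (isClosed_eq (by fun_prop) continuous_const)) fun ε hε => ?_
    obtain ⟨u, -, hu, hlt⟩ := h ε hε
    obtain ⟨U, hU⟩ := hu.1.exists_coeff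
    exact ⟨dStarOp u, sA U, ⟨sA_sA U, sA_apply_zero U ∅⟩, hu.2, hasCoeff_dStarOp hU, hlt⟩
  obtain ⟨u, hup, hu, hU⟩ := exists_form_of_coeff
    (summable_dA fun j J => summable_cD_div ((hw J).summable (hW J)) J.card j)
    (dA_eq_zero_of_card fun J hJ => nA_eq_zero (hwp.coeff_eq_zero hW hJ))
  have hd : dStarOp u = w := form_eq_of_coeff (hasCoeff_dStarOp hU) hW (sA_dA_nA hsW.1 hsW.2)
  exact ⟨u, hup, ⟨hu, hd ▸ hw⟩, hd⟩

/-- In `A²_{(p,0)}(ℂⁿ, e^{-|z|²})`, `1 ≤ p ≤ n−1`: `(ker ∂)^⊥ = ker ∂*`, and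
both `∂` and `∂*` have closed range. -/
theorem stmt11 {n p : ℕ} (hp : 1 ≤ p) (hpn : p ≤ n - 1) :
    -- (ker ∂)^⊥ = ker ∂*
    (∀ u : FormC n, IsDeg p u → MemA2 u →
      ((∀ v : FormC n, IsDeg p v → MemA2 v → dOp v = 0 → formInner u v = 0) ↔
        dStarOp u = 0)) ∧
    -- ∂ has closed range
    (∀ v : FormC n, IsDeg (p + 1) v → MemA2 v →
      (∀ ε : ℝ, 0 < ε → ∃ u : FormC n, IsDeg p u ∧ domD u ∧
        formNormSq (fun J z => dOp u J z - v J z) < ε) →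
      ∃ u : FormC n, IsDeg p u ∧ domD u ∧ dOp u = v) ∧
    -- ∂* has closed range
    (∀ w : FormC n, IsDeg (p - 1) w → MemA2 w →
      (∀ ε : ℝ, 0 < ε → ∃ u : FormC n, IsDeg p u ∧ domDs u ∧
        formNormSq (fun J z => dStarOp u J z - w J z) < ε) →
      ∃ u : FormC n, IsDeg p u ∧ domDs u ∧ dStarOp u = w) := by
  obtain ⟨p, rfl⟩ := Nat.exists_eq_add_of_le' hp
  exact ⟨fun u hup hu => ⟨dStarOp_eq_zero hup hu, fun h v hvp hv => formInner_eq_zero hu hvp hv h⟩,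
    fun v hvp hv => exists_dOp_eq hvp hv, fun w hwp hw => exists_dStarOp_eq hwp hw⟩
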